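/- There exists a constant k > 0 with the following properties, where for each integer M ≥ 1, t_M ∈ 𝒯_M denotes the equally spaced list with entries (t_M)_j = j − M − 1/2 for j = 1, …, 2M (so B^{(M)}_{t_M} describes M backflow intervals of unit length separated by gaps of unit length): (i) sSup σ(B^{(M)}_{t_M}) ≥ k·M^{1/4} for every even integer M ≥ 2; (ii) liminf_{M→∞} M^{−1/4}·sSup σ(B^{(M)}_{t_M}) ≥ k; (iii) limsup_{M→∞} M^{−1/4}·sInf σ(B^{(M)}_{t_M}) ≤ −k, where the limits in (ii) and (iii) are over all integers M → ∞. -/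

import Mathlib

open MeasureTheory Filter

noncomputable section

namespace QB

/-- Lebesgue measure on the positive half-line. -/
abbrev μp : Measure ℝ := volume.restrict (Set.Ioi (0:ℝ))

/-- The Hilbert space `L²((0,∞))`. -/
abbrev Hp : Type := Lp ℂ 2 μp

/-- The Hilbert space `L²(ℝ)`. -/
abbrev HL : Type := Lp ℂ 2 (volume : Measure ℝ)

/-- The defining properties of the operators: `S t` is multiplication by `e^{-i k² t}`,
`R` is the isometry "extend by zero and apply the inverse Fourier–Plancherel transform"
(characterised by its isometry property together with the integral formula on
integrable elements of `L²((0,∞))`, which determine it uniquely by continuity and density),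
and `Pm` is the orthogonal projection onto functions supported in `(-∞,0)`. -/
structure Setup (S : ℝ → Hp →L[ℂ] Hp) (R : Hp →L[ℂ] HL) (Pm : HL →L[ℂ] HL) : Prop where
  hS : ∀ (t : ℝ) (φ : Hp),
    (S t φ : ℝ → ℂ) =ᵐ[μp] fun k => Complex.exp (-Complex.I * (k:ℂ)^2 * (t:ℂ)) * φ k
  hR_isometry : ∀ φ : Hp, ‖R φ‖ = ‖φ‖
  hR : ∀ φ : Hp, Integrable (φ : ℝ → ℂ) μp →
    (R φ : ℝ → ℂ) =ᵐ[volume]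
      fun x => (((2 * Real.pi) ^ (-(1/2) : ℝ) : ℝ) : ℂ) *
        ∫ k in Set.Ioi (0:ℝ), Complex.exp (Complex.I * (x:ℂ) * (k:ℂ)) * φ k
  hPm : ∀ ψ : HL, (Pm ψ : ℝ → ℂ) =ᵐ[volume] Set.indicator (Set.Iio (0:ℝ)) (fun x => ψ x)

/-- The single backflow operator `B_{⟨t₁,t₂⟩} = S_{t₂}* R* Π⁻ R S_{t₂} − S_{t₁}* R* Π⁻ R S_{t₁}`. -/
def B1 (S : ℝ → Hp →L[ℂ] Hp) (R : Hp →L[ℂ] HL) (Pm : HL →L[ℂ] HL) (t₁ t₂ : ℝ) :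
    Hp →L[ℂ] Hp :=
  (ContinuousLinearMap.adjoint (S t₂)).comp ((ContinuousLinearMap.adjoint R).comp
    (Pm.comp (R.comp (S t₂))))
  - (ContinuousLinearMap.adjoint (S t₁)).comp ((ContinuousLinearMap.adjoint R).comp
    (Pm.comp (R.comp (S t₁))))

/-- The `M`-fold backflow operator `B^{(M)}_t = Σ_{j=1}^M B_{⟨t_{2j-1}, t_{2j}⟩}`
(zero-based indexing of the tuple `t`). -/
def BM (S : ℝ → Hp →L[ℂ] Hp) (R : Hp →L[ℂ] HL) (Pm : HL →L[ℂ] HL) (M : ℕ)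
    (t : Fin (2*M) → ℝ) : Hp →L[ℂ] Hp :=
  ∑ j : Fin M, B1 S R Pm (t ⟨2*j.1, by have := j.isLt; omega⟩)
    (t ⟨2*j.1+1, by have := j.isLt; omega⟩)

/-- `𝒯_M`: the set of strictly increasing `2M`-tuples of reals. -/
def TM (M : ℕ) : Set (Fin (2*M) → ℝ) := {t | StrictMono t}

/-- The equally spaced list of times `(t_M)_j = j − M − 1/2`, `j = 1, …, 2M`
(zero-based: entry `i` is `(i+1) − M − 1/2`). -/
def tMlist (M : ℕ) : Fin (2*M) → ℝ := fun i => (i:ℝ) + 1/2 - (M:ℝ)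

/-- The Fourier transform of the indicator function of the `M` unit backflow intervals. -/
def dker (M : ℕ) (ω : ℝ) : ℝ :=
  Real.sinc (ω / 2) * ∑ j ∈ Finset.range M, Real.cos (ω * (2 * j + 1 - M))

/-- The absolute value of the Fourier transform of the distributional derivative of that
indicator. -/
def gker (M : ℕ) (ω : ℝ) : ℝ := |ω * dker M ω|

lemma continuous_dker (M : ℕ) : Continuous (dker M) := by
  unfold dker
  have := Real.continuous_sinc
  fun_prop

lemma continuous_gker (M : ℕ) : Continuous (gker M) := by
  unfold gker
  have := continuous_dker M
  fun_prop

lemma gker_nonneg (M : ℕ) (ω : ℝ) : 0 ≤ gker M ω := abs_nonneg _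

lemma dker_neg (M : ℕ) (ω : ℝ) : dker M (-ω) = dker M ω := by
  unfold dker
  rw [neg_div, Real.sinc_neg]
  simp [neg_mul]

lemma gker_neg (M : ℕ) (ω : ℝ) : gker M (-ω) = gker M ω := by
  unfold gker
  rw [dker_neg, neg_mul, abs_neg]

lemma abs_sum_cos_le (M : ℕ) (ω : ℝ) :
    |∑ j ∈ Finset.range M, Real.cos (ω * (2 * j + 1 - M))| ≤ M := by
  refine (Finset.abs_sum_le_sum_abs _ _).trans ?_
  refine (Finset.sum_le_sum fun j _ => Real.abs_cos_le_one _).trans ?_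
  simp

lemma abs_dker_le (M : ℕ) (ω : ℝ) : |dker M ω| ≤ M := by
  unfold dker
  rw [abs_mul]
  calc _ ≤ 1 * (M : ℝ) := by
        gcongr
        · exact Real.abs_sinc_le_one _
        · exact abs_sum_cos_le M ω
    _ = M := one_mul _

lemma mul_sinc_half (ω : ℝ) : ω * Real.sinc (ω / 2) = 2 * Real.sin (ω / 2) := by
  by_cases h : ω = 0
  · simp [h]
  · rw [Real.sinc_of_ne_zero (by positivity)]
    field_simp

lemma gker_le (M : ℕ) (ω : ℝ) : gker M ω ≤ 2 * M := by
  unfold gker dker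
  rw [← mul_assoc, mul_sinc_half, abs_mul, abs_mul, abs_two]
  have := Real.abs_sin_le_one (ω / 2)
  have h2 := abs_sum_cos_le M ω
  have : 2 * |Real.sin (ω / 2)| ≤ 2 := by linarith
  gcongr

lemma sin_mul_sum_cos (M : ℕ) (ω : ℝ) :
    Real.sin ω * ∑ j ∈ Finset.range M, Real.cos (ω * (2 * j + 1 - M)) = Real.sin (M * ω) := by
  have h : ∀ n : ℕ, Real.sin ω * ∑ j ∈ Finset.range n, Real.cos (ω * (2 * j + 1 - M)) =
      (Real.sin (ω * (2 * n - M)) + Real.sin (M * ω)) / 2 := by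
    intro n
    induction n with
    | zero => simp [mul_comm]
    | succ n ih =>
      rw [Finset.sum_range_succ, mul_add, ih]
      push_cast
      have e1 : ω * (2 * (n + 1 : ℝ) - M) = ω * (2 * n + 1 - M) + ω := by ring
      have e2 : ω * (2 * (n : ℝ) - M) = ω * (2 * n + 1 - M) - ω := by ring
      rw [e1, e2, Real.sin_add, Real.sin_sub]
      ring
  rw [h M, show ω * (2 * (M : ℝ) - M) = M * ω by ring]
  ring

lemma mul_dker_mul_cos (M : ℕ) (ω : ℝ) :
    ω * dker M ω * Real.cos (ω / 2) = Real.sin (M * ω) := by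
  rw [← sin_mul_sum_cos]
  unfold dker
  rw [← mul_assoc, mul_sinc_half]
  have : Real.sin ω = 2 * Real.sin (ω / 2) * Real.cos (ω / 2) := by
    rw [← Real.sin_two_mul]; ring_nf
  rw [this]; ring

lemma gker_mul_abs_cos_le (M : ℕ) (ω : ℝ) : gker M ω * |Real.cos (ω / 2)| ≤ 1 := by
  unfold gker
  rw [← abs_mul, mul_dker_mul_cos]
  exact Real.abs_sin_le_one _

lemma gker_le_two {M : ℕ} {ω : ℝ} (h : |ω| ≤ 1) : gker M ω ≤ 2 := by
  have h1 := gker_mul_abs_cos_le M ω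
  have h2 : 1 / 2 ≤ |Real.cos (ω / 2)| := by
    refine le_trans ?_ (le_abs_self _)
    have := Real.one_sub_sq_div_two_le_cos (x := ω / 2)
    nlinarith [abs_le.1 h, sq_abs ω, abs_nonneg ω]
  nlinarith [gker_nonneg M ω]

lemma gker_periodic (M : ℕ) : Function.Periodic (gker M) (2 * Real.pi) := by
  intro ω
  unfold gker dker
  rw [← mul_assoc, mul_sinc_half, ← mul_assoc, mul_sinc_half]
  have e1 : (ω + 2 * Real.pi) / 2 = ω / 2 + Real.pi := by ring
  rw [e1, Real.sin_add_pi]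
  have e2 : ∀ j : ℕ, Real.cos ((ω + 2 * Real.pi) * (2 * j + 1 - M)) =
      Real.cos (ω * (2 * j + 1 - M)) := by
    intro j
    have := Real.cos_add_int_mul_two_pi (ω * (2 * j + 1 - M)) (2 * j + 1 - M)
    rw [← this]; push_cast; ring_nf
  simp only [e2]
  rw [mul_neg, neg_mul, abs_neg]

lemma gker_pi_add_le {M : ℕ} {θ : ℝ} (h : |θ| ≤ Real.pi) (h0 : θ ≠ 0) :
    gker M (Real.pi + θ) ≤ Real.pi / |θ| := by
  have h1 := gker_mul_abs_cos_le M (Real.pi + θ)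
  have e : (Real.pi + θ) / 2 = θ / 2 + Real.pi / 2 := by ring
  rw [e, Real.cos_add_pi_div_two, abs_neg] at h1
  have h2 : |θ| / Real.pi ≤ |Real.sin (θ / 2)| := by
    have := Real.mul_abs_le_abs_sin (x := θ / 2) (by rw [abs_div, abs_two]; linarith)
    rw [abs_div, abs_two] at this
    calc _ = 2 / Real.pi * (|θ| / 2) := by ring
      _ ≤ _ := this
  have hpi := Real.pi_pos
  have hθ : 0 < |θ| := abs_pos.2 h0
  rw [le_div_iff₀ hθ]
  have h3 : gker M (Real.pi + θ) * (|θ| / Real.pi) ≤ 1 :=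
    (mul_le_mul_of_nonneg_left h2 (gker_nonneg _ _)).trans h1
  rw [← mul_div_assoc, div_le_iff₀ hpi] at h3
  linarith

/-- Near `π` the kernel is comparable with `M` and has a definite sign. -/
lemma le_neg_one_pow_mul_dker {M : ℕ} (hM : 1 ≤ M) {θ : ℝ} (h0 : 0 < θ)
    (hθ : M * θ ≤ Real.pi / 2) :
    2 / 5 * (M : ℝ) ≤ (-1) ^ (M + 1) * dker M (Real.pi - θ) := by
  have hM' : (1 : ℝ) ≤ M := by exact_mod_cast hM
  have hpi := Real.pi_pos
  have hθ' : θ ≤ Real.pi / 2 := by nlinarith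
  have h1 := mul_dker_mul_cos M (Real.pi - θ)
  have e : (Real.pi - θ) / 2 = Real.pi / 2 - θ / 2 := by ring
  rw [e, Real.cos_pi_div_two_sub] at h1
  have e3 : Real.sin (M * (Real.pi - θ)) = (-1) ^ (M + 1) * Real.sin (M * θ) := by
    rw [mul_sub, Real.sin_sub, Real.sin_nat_mul_pi, Real.cos_nat_mul_pi]; ring
  rw [e3] at h1
  set σ : ℝ := (-1) ^ (M + 1) with hσ
  have hσ2 : σ * σ = 1 := by rw [hσ, ← pow_add, ← two_mul, pow_mul]; simp
  have hs : 2 / Real.pi * (M * θ) ≤ Real.sin (M * θ) := Real.mul_le_sin (by positivity) hθ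
  have hs2 : Real.sin (θ / 2) ≤ θ / 2 := Real.sin_le (by linarith)
  have hs3 : 0 < Real.sin (θ / 2) := Real.sin_pos_of_pos_of_lt_pi (by linarith) (by linarith)
  set X := σ * dker M (Real.pi - θ) with hX
  have h2 : (Real.pi - θ) * X * Real.sin (θ / 2) = Real.sin (M * θ) := by
    have : σ * ((Real.pi - θ) * dker M (Real.pi - θ) * Real.sin (θ / 2)) =
      σ * (σ * Real.sin (M * θ)) := by rw [h1]
    rw [← mul_assoc σ σ, hσ2, one_mul] at this
    rw [← this, hX]; ring
  have hXpos : 0 < X := by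
    have : 0 < (Real.pi - θ) * X * Real.sin (θ / 2) := by
      rw [h2]; refine lt_of_lt_of_le ?_ hs; positivity
    have := pos_of_mul_pos_left this hs3.le
    exact pos_of_mul_pos_right this (by linarith)
  have h3 : 2 / Real.pi * (M * θ) ≤ Real.pi * X * (θ / 2) := by
    refine hs.trans ?_
    rw [← h2]
    gcongr
    linarith
  have h4 : 4 * M ≤ Real.pi ^ 2 * X := by
    rw [div_mul_eq_mul_div, div_le_iff₀ hpi] at h3
    have : 4 * M * θ ≤ Real.pi ^ 2 * X * θ := by nlinarith
    exact le_of_mul_le_mul_right this h0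
  have h5 : Real.pi ^ 2 ≤ 10 := by nlinarith [Real.pi_lt_d2]
  nlinarith

lemma lintegral_Ioi_rpow {a r : ℝ} (ha : 0 < a) (hr : r < -1) :
    ∫⁻ x in Set.Ioi a, ENNReal.ofReal (x ^ r) = ENNReal.ofReal (-a ^ (r + 1) / (r + 1)) := by
  rw [← integral_Ioi_rpow_of_lt hr ha, ofReal_integral_eq_lintegral_ofReal
    (integrableOn_Ioi_rpow_of_lt hr ha)]
  filter_upwards [ae_restrict_mem measurableSet_Ioi] with x hx
  exact Real.rpow_nonneg (ha.trans hx).le _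

lemma lintegral_Ioc_rpow {a b r : ℝ} (ha : 0 ≤ a) (hab : a ≤ b) (hr : -1 < r) :
    ∫⁻ x in Set.Ioc a b, ENNReal.ofReal (x ^ r) =
      ENNReal.ofReal ((b ^ (r + 1) - a ^ (r + 1)) / (r + 1)) := by
  rw [← integral_rpow (Or.inl hr), intervalIntegral.integral_of_le hab,
    ofReal_integral_eq_lintegral_ofReal]
  · exact (intervalIntegral.intervalIntegrable_rpow' hr).1
  · filter_upwards [ae_restrict_mem measurableSet_Ioc] with x hx
    exact Real.rpow_nonneg (ha.trans hx.1.le) _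

lemma lintegral_Ioi_mul_comp_sq {a : ℝ} (ha : 0 ≤ a) (F : ℝ → ENNReal) :
    ∫⁻ q in Set.Ioi a, ENNReal.ofReal (2 * q) * F (q ^ 2) = ∫⁻ u in Set.Ioi (a ^ 2), F u := by
  have himg : (fun x : ℝ => x ^ 2) '' Set.Ioi a = Set.Ioi (a ^ 2) := by
    ext y
    simp only [Set.mem_image, Set.mem_Ioi]
    constructor
    · rintro ⟨x, hx, rfl⟩; gcongr
    · intro hy
      have hy0 : 0 ≤ y := (sq_nonneg a).trans hy.le
      exact ⟨Real.sqrt y, Real.lt_sqrt_of_sq_lt hy, Real.sq_sqrt hy0⟩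
  rw [← himg, lintegral_image_eq_lintegral_abs_deriv_mul (f' := fun x => 2 * x) measurableSet_Ioi]
  · refine setLIntegral_congr_fun measurableSet_Ioi fun x hx => ?_
    have : 0 ≤ 2 * x := by have := ha.trans hx.le; linarith
    simp only [abs_of_nonneg this]
  · intro x _
    simpa using (hasDerivAt_pow 2 x).hasDerivWithinAt
  · intro x hx y hy h
    have := ha.trans_lt hx
    have := ha.trans_lt hy
    exact (pow_left_inj₀ (by positivity) (by positivity) two_ne_zero).1 h

/-- Comparison of a weighted integral of a function whose integrals over windows of length `T`
are bounded with the integral of the weight. -/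
lemma mul_setLIntegral_mul_le {T : ℝ} {h : ℝ → ENNReal} (hh : Measurable h)
    {H : ENNReal} (hH : ∀ v, ∫⁻ u in Set.Ico (v - T) v, h u ≤ H) {W V : ℝ → ENNReal}
    (hV : Measurable V) {s : Set ℝ} (hs : MeasurableSet s)
    (hWV : ∀ u ∈ s, ∀ v ∈ Set.Ioc u (u + T), W u ≤ V v) :
    ENNReal.ofReal T * ∫⁻ u in s, W u * h u ≤ H * ∫⁻ v, V v := by
  calc ENNReal.ofReal T * ∫⁻ u in s, W u * h u
      = ∫⁻ u in s, ENNReal.ofReal T * (W u * h u) := by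
        rw [lintegral_const_mul' _ _ ENNReal.ofReal_ne_top]
    _ ≤ ∫⁻ u in s, ∫⁻ v, (Set.Ioc u (u + T)).indicator V v * h u := by
        refine setLIntegral_mono' hs fun u hu => ?_
        rw [lintegral_mul_const _ (hV.indicator measurableSet_Ioc), ← mul_assoc]
        gcongr
        rw [lintegral_indicator measurableSet_Ioc]
        calc ENNReal.ofReal T * W u = ∫⁻ v in Set.Ioc u (u + T), W u := by
              simp [mul_comm]
          _ ≤ _ := setLIntegral_mono' measurableSet_Ioc fun v hv => hWV u hu v hv
    _ ≤ ∫⁻ u, ∫⁻ v, (Set.Ioc u (u + T)).indicator V v * h u := setLIntegral_le_lintegral _ _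
    _ = ∫⁻ v, ∫⁻ u, (Set.Ioc u (u + T)).indicator V v * h u := by
        refine lintegral_lintegral_swap (Measurable.aemeasurable ?_)
        refine Measurable.mul ?_ (hh.comp measurable_fst)
        have : (Function.uncurry fun u v => (Set.Ioc u (u + T)).indicator V v) =
            Set.indicator {p : ℝ × ℝ | p.1 < p.2 ∧ p.2 ≤ p.1 + T} (fun p => V p.2) := by
          ext p; simp [Function.uncurry, Set.indicator]
        simp only [Function.uncurry_def] at this ⊢
        rw [this]
        refine (hV.comp measurable_snd).indicator ?_
        exact (measurableSet_lt measurable_fst measurable_snd).inter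
          (measurableSet_le measurable_snd (measurable_fst.add_const T))
    _ ≤ ∫⁻ v, H * V v := by
        refine lintegral_mono fun v => ?_
        calc ∫⁻ u, (Set.Ioc u (u + T)).indicator V v * h u
            = ∫⁻ u, (Set.Ico (v - T) v).indicator (fun u => V v * h u) u := by
              refine lintegral_congr fun u => ?_
              by_cases hu : u ∈ Set.Ico (v - T) v
              · rw [Set.indicator_of_mem hu, Set.indicator_of_mem]
                exact ⟨hu.2, by linarith [hu.1]⟩
              · rw [Set.indicator_of_notMem hu, Set.indicator_of_notMem, zero_mul]
                exact fun h' => hu ⟨by linarith [h'.2], h'.1⟩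
          _ = V v * ∫⁻ u in Set.Ico (v - T) v, h u := by
              rw [lintegral_indicator measurableSet_Ico, lintegral_const_mul _ hh]
          _ ≤ H * V v := by rw [mul_comm]; gcongr; exact hH v
    _ = H * ∫⁻ v, V v := lintegral_const_mul _ hV

lemma intervalIntegral_gker_rpow_le {M : ℕ} (hM : 1 ≤ M) (v : ℝ) :
    ∫ ω in v..v + 2 * Real.pi, gker M ω ^ ((5 : ℝ) / 4) ≤ 100 * (M : ℝ) ^ ((1 : ℝ) / 4) := by
  have hM' : (1 : ℝ) ≤ M := by exact_mod_cast hM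
  have hM0 : (0 : ℝ) < M := by linarith
  have hpi := Real.pi_pos
  have hc : Continuous fun ω => gker M ω ^ ((5 : ℝ) / 4) :=
    (continuous_gker M).rpow_const fun _ => Or.inr (by norm_num)
  have hp : Function.Periodic (fun ω => gker M ω ^ ((5 : ℝ) / 4)) (2 * Real.pi) := fun ω => by
    simp only [gker_periodic M ω]
  set f : ℝ → ℝ := fun θ => gker M (Real.pi + θ) ^ ((5 : ℝ) / 4) with hf
  have hfc : Continuous f := hc.comp (by fun_prop)
  have heven : ∀ θ, f (-θ) = f θ := by
    intro θ
    simp only [hf]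
    rw [← gker_neg, ← gker_periodic M (-(Real.pi + -θ))]
    ring_nf
  have e1 : ∫ ω in v..v + 2 * Real.pi, gker M ω ^ ((5 : ℝ) / 4) =
      ∫ θ in (-Real.pi)..Real.pi, f θ := by
    rw [hp.intervalIntegral_add_eq v 0, hf,
      intervalIntegral.integral_comp_add_left (fun x => gker M x ^ ((5 : ℝ) / 4))]
    congr 1 <;> ring
  have e2 : ∫ θ in (-Real.pi)..Real.pi, f θ = 2 * ∫ θ in (0 : ℝ)..Real.pi, f θ := by
    rw [← intervalIntegral.integral_add_adjacent_intervals (b := 0)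
      (hfc.intervalIntegrable _ _) (hfc.intervalIntegrable _ _)]
    have : ∫ θ in (-Real.pi)..0, f θ = ∫ θ in (0 : ℝ)..Real.pi, f θ := by
      have h := intervalIntegral.integral_comp_neg (a := 0) (b := Real.pi) f
      simp only [neg_zero, heven] at h
      exact h.symm
    rw [this]; ring
  have hMi : (M : ℝ)⁻¹ ≤ 1 := inv_le_one_of_one_le₀ hM'
  have hMpi : (M : ℝ)⁻¹ ≤ Real.pi := by linarith [Real.pi_gt_three]
  have hMi0 : 0 < (M : ℝ)⁻¹ := by positivity
  have b1 : ∫ θ in (0 : ℝ)..(M : ℝ)⁻¹, f θ ≤ 4 * (M : ℝ) ^ ((1 : ℝ) / 4) := by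
    calc ∫ θ in (0 : ℝ)..(M : ℝ)⁻¹, f θ
        ≤ ∫ θ in (0 : ℝ)..(M : ℝ)⁻¹, (2 * M : ℝ) ^ ((5 : ℝ) / 4) := by
          refine intervalIntegral.integral_mono_on hMi0.le (hfc.intervalIntegrable _ _)
            (by simp) fun x _ => ?_
          exact Real.rpow_le_rpow (gker_nonneg _ _) (gker_le _ _) (by norm_num)
      _ = (2 : ℝ) ^ ((5 : ℝ) / 4) * (M : ℝ) ^ ((1 : ℝ) / 4) := by
          rw [intervalIntegral.integral_const, smul_eq_mul, sub_zero,
            Real.mul_rpow (by norm_num) hM0.le,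
            show ((5 : ℝ) / 4) = 1 + 1 / 4 by norm_num, Real.rpow_add hM0, Real.rpow_one]
          field_simp
      _ ≤ (2 : ℝ) ^ (2 : ℝ) * (M : ℝ) ^ ((1 : ℝ) / 4) := by
          gcongr <;> norm_num
      _ = _ := by norm_num
  have b2 : ∫ θ in (M : ℝ)⁻¹..Real.pi, f θ ≤ 44 * (M : ℝ) ^ ((1 : ℝ) / 4) := by
    have hInt : IntervalIntegrable
        (fun θ : ℝ => Real.pi ^ ((5 : ℝ) / 4) * θ ^ (-(5 : ℝ) / 4)) volume
        (M : ℝ)⁻¹ Real.pi := by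
      refine ContinuousOn.intervalIntegrable ?_
      refine continuousOn_const.mul (ContinuousOn.rpow_const continuousOn_id fun x hx => Or.inl ?_)
      rw [Set.uIcc_of_le hMpi] at hx
      exact (hMi0.trans_le hx.1).ne'
    calc ∫ θ in (M : ℝ)⁻¹..Real.pi, f θ
        ≤ ∫ θ in (M : ℝ)⁻¹..Real.pi, Real.pi ^ ((5 : ℝ) / 4) * θ ^ (-(5 : ℝ) / 4) := by
          refine intervalIntegral.integral_mono_on hMpi (hfc.intervalIntegrable _ _) hInt
            fun x hx => ?_
          have hx0 : 0 < x := hMi0.trans_le hx.1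
          have := gker_pi_add_le (M := M) (θ := x) (by rw [abs_of_pos hx0]; exact hx.2) hx0.ne'
          rw [abs_of_pos hx0] at this
          calc f x ≤ (Real.pi / x) ^ ((5 : ℝ) / 4) :=
                Real.rpow_le_rpow (gker_nonneg _ _) this (by norm_num)
            _ = _ := by
                rw [Real.div_rpow hpi.le hx0.le, neg_div, Real.rpow_neg hx0.le, div_eq_mul_inv]
      _ = Real.pi ^ ((5 : ℝ) / 4) * (4 * ((M : ℝ) ^ ((1 : ℝ) / 4) - Real.pi ^ (-(1 : ℝ) / 4))) := by
          rw [intervalIntegral.integral_const_mul, integral_rpow]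
          · congr 1
            rw [show (-(5 : ℝ) / 4 + 1) = -(1 / 4) by norm_num, Real.inv_rpow hM0.le,
              Real.rpow_neg hM0.le, inv_inv]
            ring_nf
          · refine Or.inr ⟨by norm_num, ?_⟩
            rw [Set.uIcc_of_le hMpi]
            exact fun h => absurd h.1 (not_le.2 hMi0)
      _ ≤ 11 * (4 * (M : ℝ) ^ ((1 : ℝ) / 4)) := by
          have h1 : Real.pi ^ ((5 : ℝ) / 4) ≤ 11 := by
            calc Real.pi ^ ((5 : ℝ) / 4) ≤ Real.pi ^ (2 : ℝ) :=
                  Real.rpow_le_rpow_of_exponent_le (by linarith [Real.pi_gt_three]) (by norm_num)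
              _ ≤ 11 := by
                  rw [Real.rpow_two]; nlinarith [Real.pi_lt_d2]
          have h2 : 0 ≤ Real.pi ^ (-(1 : ℝ) / 4) := Real.rpow_nonneg hpi.le _
          have h3 : 0 ≤ (M : ℝ) ^ ((1 : ℝ) / 4) := Real.rpow_nonneg hM0.le _
          have h4 : 0 ≤ Real.pi ^ ((5 : ℝ) / 4) := Real.rpow_nonneg hpi.le _
          calc _ ≤ Real.pi ^ ((5 : ℝ) / 4) * (4 * (M : ℝ) ^ ((1 : ℝ) / 4)) := by
                gcongr; linarith
            _ ≤ _ := by gcongr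
      _ = _ := by ring
  rw [e1, e2, ← intervalIntegral.integral_add_adjacent_intervals (b := (M : ℝ)⁻¹)
      (hfc.intervalIntegrable _ _) (hfc.intervalIntegrable _ _)]
  have h3 : 0 ≤ (M : ℝ) ^ ((1 : ℝ) / 4) := Real.rpow_nonneg hM0.le _
  linarith

lemma lintegral_Ioc_gker_rpow_le {M : ℕ} (hM : 1 ≤ M) (v : ℝ) :
    ∫⁻ ω in Set.Ioc v (v + 2 * Real.pi), ENNReal.ofReal (gker M ω ^ ((5 : ℝ) / 4)) ≤
      ENNReal.ofReal (100 * (M : ℝ) ^ ((1 : ℝ) / 4)) := by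
  have hc : Continuous fun ω => gker M ω ^ ((5 : ℝ) / 4) :=
    (continuous_gker M).rpow_const fun _ => Or.inr (by norm_num)
  rw [← ofReal_integral_eq_lintegral_ofReal ((hc.intervalIntegrable v (v + 2 * Real.pi)).1)
    (Eventually.of_forall fun ω => Real.rpow_nonneg (gker_nonneg _ _) _),
    ← intervalIntegral.integral_of_le (by linarith [Real.pi_pos])]
  exact ENNReal.ofReal_le_ofReal (intervalIntegral_gker_rpow_le hM v)

lemma lintegral_Ico_gker_const_sub_le {M : ℕ} (hM : 1 ≤ M) (c v : ℝ) :
    ∫⁻ u in Set.Ico (v - 2 * Real.pi) v, ENNReal.ofReal (gker M (c - u) ^ ((5 : ℝ) / 4)) ≤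
      ENNReal.ofReal (100 * (M : ℝ) ^ ((1 : ℝ) / 4)) := by
  refine le_trans (le_of_eq ?_) (lintegral_Ioc_gker_rpow_le hM (c - v))
  rw [← lintegral_indicator measurableSet_Ico, ← lintegral_indicator measurableSet_Ioc,
    ← lintegral_sub_left_eq_self
      ((Set.Ioc (c - v) (c - v + 2 * Real.pi)).indicator _) c]
  refine lintegral_congr fun u => ?_
  by_cases hu : u ∈ Set.Ico (v - 2 * Real.pi) v
  · rw [Set.indicator_of_mem hu, Set.indicator_of_mem]
    exact ⟨by linarith [hu.2], by linarith [hu.1]⟩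
  · rw [Set.indicator_of_notMem hu, Set.indicator_of_notMem]
    exact fun h' => hu ⟨by linarith [h'.2], by linarith [h'.1]⟩

lemma measurable_ofReal_gker_rpow (M : ℕ) (c : ℝ) :
    Measurable fun u => ENNReal.ofReal (gker M (c - u) ^ ((5 : ℝ) / 4)) := by
  have := (continuous_gker M).measurable
  fun_prop

lemma le_of_ofReal_two_pi_mul_le {X Y : ENNReal}
    (h : ENNReal.ofReal (2 * Real.pi) * X ≤ Y) : X ≤ Y := by
  refine le_trans ?_ h
  have : (1 : ENNReal) ≤ ENNReal.ofReal (2 * Real.pi) := by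
    rw [ENNReal.one_le_ofReal]; linarith [Real.pi_gt_three]
  exact le_mul_of_one_le_left (zero_le) this

lemma rpow_le_of_le_eight_mul {u v s : ℝ} (hu : 0 < u) (hv : 0 < v) (huv : v ≤ 8 * u)
    (hs : 0 ≤ s) : u ^ (-s) ≤ 8 ^ s * v ^ (-s) := by
  rw [Real.rpow_neg hu.le, Real.rpow_neg hv.le, ← div_eq_mul_inv, inv_eq_one_div,
    div_le_div_iff₀ (Real.rpow_pos_of_pos hu _) (Real.rpow_pos_of_pos hv _), one_mul,
    ← Real.mul_rpow (by norm_num) hu.le]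
  exact Real.rpow_le_rpow hv.le huv hs

lemma eight_rpow_le {s : ℝ} {n : ℝ} (h : 3 * s ≤ n) : (8 : ℝ) ^ s ≤ 2 ^ n := by
  rw [show (8 : ℝ) = 2 ^ (3 : ℝ) by norm_num, ← Real.rpow_mul (by norm_num)]
  exact Real.rpow_le_rpow_of_exponent_le (by norm_num) h

lemma lintegral_Ioi_gker_mul_rpow_le {M : ℕ} (hM : 1 ≤ M) (c : ℝ) {p : ℝ} (hp : 1 ≤ p) :
    ∫⁻ q in Set.Ioi p, ENNReal.ofReal (gker M (c - q ^ 2) ^ ((5 : ℝ) / 4) * q ^ (-(3 : ℝ) / 2)) ≤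
      ENNReal.ofReal (3200 * (M : ℝ) ^ ((1 : ℝ) / 4) * p ^ (-(1 : ℝ) / 2)) := by
  have hp0 : 0 < p := by linarith
  have hpp : 1 ≤ p ^ 2 := one_le_pow₀ hp
  have hV : Measurable ((Set.Ioi (p ^ 2)).indicator
      fun v : ℝ => ENNReal.ofReal (8 * v ^ (-(5 : ℝ) / 4))) :=
    Measurable.indicator (by fun_prop) measurableSet_Ioi
  have key := mul_setLIntegral_mul_le (measurable_ofReal_gker_rpow M c)
    (lintegral_Ico_gker_const_sub_le hM c)
    (W := fun u => ENNReal.ofReal (1 / 2 * u ^ (-(5 : ℝ) / 4))) hV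
    (measurableSet_Ioi (a := p ^ 2)) (by
      intro u hu v hv
      have hu' : p ^ 2 < u := hu
      rw [Set.indicator_of_mem (show v ∈ Set.Ioi (p ^ 2) from hu'.trans hv.1)]
      refine ENNReal.ofReal_le_ofReal ?_
      have hu1 : 0 < u := by linarith
      have hv1 : 0 < v := hu1.trans hv.1
      have hv2 : v ≤ 8 * u := by linarith [hv.2, Real.pi_lt_d2]
      have h1 := rpow_le_of_le_eight_mul hu1 hv1 hv2 (s := 5 / 4) (by norm_num)
      have h2 : (8 : ℝ) ^ ((5 : ℝ) / 4) ≤ 16 :=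
        (eight_rpow_le (n := (4 : ℕ)) (by norm_num)).trans (by rw [Real.rpow_natCast]; norm_num)
      have h3 : 0 ≤ v ^ (-((5 : ℝ) / 4)) := Real.rpow_nonneg hv1.le _
      rw [neg_div]
      nlinarith)
  have key2 := le_of_ofReal_two_pi_mul_le key
  rw [lintegral_indicator measurableSet_Ioi] at key2
  calc ∫⁻ q in Set.Ioi p, ENNReal.ofReal (gker M (c - q ^ 2) ^ ((5 : ℝ) / 4) * q ^ (-(3 : ℝ) / 2))
      = ∫⁻ q in Set.Ioi p, ENNReal.ofReal (2 * q) *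
          ((fun u => ENNReal.ofReal (1 / 2 * u ^ (-(5 : ℝ) / 4)) *
            ENNReal.ofReal (gker M (c - u) ^ ((5 : ℝ) / 4))) (q ^ 2)) := by
        refine setLIntegral_congr_fun measurableSet_Ioi fun q hq => ?_
        have hq0 : 0 < q := hp0.trans hq
        simp only
        rw [← ENNReal.ofReal_mul (by positivity), ← ENNReal.ofReal_mul (by positivity)]
        congr 1
        rw [← Real.rpow_natCast q 2, ← Real.rpow_mul hq0.le]
        have : q ^ (-(3 : ℝ) / 2) = q * q ^ (((2 : ℕ) : ℝ) * (-5 / 4)) := by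
          rw [← Real.rpow_one_add' hq0.le (by norm_num)]
          norm_num
        rw [this]; ring
    _ = _ := lintegral_Ioi_mul_comp_sq hp0.le
          (fun u => ENNReal.ofReal (1 / 2 * u ^ (-(5 : ℝ) / 4)) *
        ENNReal.ofReal (gker M (c - u) ^ ((5 : ℝ) / 4)))
    _ ≤ _ := key2
    _ = ENNReal.ofReal (100 * (M : ℝ) ^ ((1 : ℝ) / 4)) *
        ENNReal.ofReal (32 * p ^ (-(1 : ℝ) / 2)) := by
        congr 1
        have : ∀ v : ℝ, ENNReal.ofReal (8 * v ^ (-(5 : ℝ) / 4)) =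
          ENNReal.ofReal 8 * ENNReal.ofReal (v ^ (-(5 : ℝ) / 4)) :=
          fun v => ENNReal.ofReal_mul (by norm_num)
        simp_rw [this]
        rw [lintegral_const_mul _ (by fun_prop), lintegral_Ioi_rpow (by positivity) (by norm_num),
          ← ENNReal.ofReal_mul (by norm_num)]
        congr 1
        rw [← Real.rpow_natCast p 2, ← Real.rpow_mul hp0.le]
        norm_num
        ring
    _ = _ := by
        rw [← ENNReal.ofReal_mul (by positivity)]
        congr 1; ring

lemma lintegral_Ioc_one_gker_mul_rpow_le {M : ℕ} (hM : 1 ≤ M) (c : ℝ) {k : ℝ} (hk : 1 ≤ k) :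
    ∫⁻ q in Set.Ioc 1 k, ENNReal.ofReal (gker M (c - q ^ 2) ^ ((5 : ℝ) / 4) * q ^ (-(1 : ℝ) / 2)) ≤
      ENNReal.ofReal (3200 * (M : ℝ) ^ ((1 : ℝ) / 4) * k ^ ((1 : ℝ) / 2)) := by
  have hk0 : 0 < k := by linarith
  have hkk : 1 ≤ k ^ 2 := one_le_pow₀ hk
  have hV : Measurable ((Set.Ioc 0 (8 * k ^ 2)).indicator
      fun v : ℝ => ENNReal.ofReal (4 * v ^ (-(3 : ℝ) / 4))) :=
    Measurable.indicator (by fun_prop) measurableSet_Ioc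
  have key := mul_setLIntegral_mul_le (measurable_ofReal_gker_rpow M c)
    (lintegral_Ico_gker_const_sub_le hM c)
    (W := (Set.Iic (k ^ 2)).indicator fun u => ENNReal.ofReal (1 / 2 * u ^ (-(3 : ℝ) / 4))) hV
    (measurableSet_Ioi (a := (1 : ℝ) ^ 2)) (by
      intro u hu v hv
      by_cases huk : u ∈ Set.Iic (k ^ 2)
      swap
      · rw [Set.indicator_of_notMem huk]; exact zero_le
      have huk' : u ≤ k ^ 2 := huk
      have hu' : 1 < u := by simpa using hu
      have hu1 : 0 < u := by linarith
      have hv1 : 0 < v := hu1.trans hv.1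
      have hv2 : v ≤ 8 * u := by linarith [hv.2, Real.pi_lt_d2]
      rw [Set.indicator_of_mem huk, Set.indicator_of_mem (show v ∈ Set.Ioc 0 (8 * k ^ 2) from
        ⟨hv1, by linarith⟩)]
      refine ENNReal.ofReal_le_ofReal ?_
      have h1 := rpow_le_of_le_eight_mul hu1 hv1 hv2 (s := 3 / 4) (by norm_num)
      have h2 : (8 : ℝ) ^ ((3 : ℝ) / 4) ≤ 8 :=
        (eight_rpow_le (n := (3 : ℕ)) (by norm_num)).trans (by rw [Real.rpow_natCast]; norm_num)
      have h3 : 0 ≤ v ^ (-((3 : ℝ) / 4)) := Real.rpow_nonneg hv1.le _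
      rw [neg_div]
      nlinarith)
  have key2 := le_of_ofReal_two_pi_mul_le key
  rw [lintegral_indicator measurableSet_Ioc] at key2
  calc ∫⁻ q in Set.Ioc 1 k, ENNReal.ofReal (gker M (c - q ^ 2) ^ ((5 : ℝ) / 4) * q ^ (-(1 : ℝ) / 2))
      ≤ ∫⁻ q in Set.Ioi 1, ENNReal.ofReal (2 * q) *
          ((fun u => (Set.Iic (k ^ 2)).indicator
            (fun u => ENNReal.ofReal (1 / 2 * u ^ (-(3 : ℝ) / 4))) u *
            ENNReal.ofReal (gker M (c - u) ^ ((5 : ℝ) / 4))) (q ^ 2)) := by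
        refine (setLIntegral_mono' measurableSet_Ioc fun q hq => ?_).trans
          (lintegral_mono_set Set.Ioc_subset_Ioi_self)
        have hq0 : 0 < q := lt_trans one_pos hq.1
        have hqk : q ^ 2 ∈ Set.Iic (k ^ 2) := by
          have := hq.2
          simp only [Set.mem_Iic]; gcongr
        simp only [Set.indicator_of_mem hqk]
        rw [← ENNReal.ofReal_mul (by positivity), ← ENNReal.ofReal_mul (by positivity)]
        refine le_of_eq ?_
        congr 1
        rw [← Real.rpow_natCast q 2, ← Real.rpow_mul hq0.le]
        have : q ^ (-(1 : ℝ) / 2) = q * q ^ (((2 : ℕ) : ℝ) * (-3 / 4)) := by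
          rw [← Real.rpow_one_add' hq0.le (by norm_num)]
          norm_num
        rw [this]; ring
    _ = _ := lintegral_Ioi_mul_comp_sq zero_le_one (fun u => (Set.Iic (k ^ 2)).indicator
        (fun u => ENNReal.ofReal (1 / 2 * u ^ (-(3 : ℝ) / 4))) u *
          ENNReal.ofReal (gker M (c - u) ^ ((5 : ℝ) / 4)))
    _ ≤ _ := key2
    _ ≤ ENNReal.ofReal (100 * (M : ℝ) ^ ((1 : ℝ) / 4)) *
        ENNReal.ofReal (32 * k ^ ((1 : ℝ) / 2)) := by
        gcongr
        have : ∀ v : ℝ, ENNReal.ofReal (4 * v ^ (-(3 : ℝ) / 4)) =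
          ENNReal.ofReal 4 * ENNReal.ofReal (v ^ (-(3 : ℝ) / 4)) :=
          fun v => ENNReal.ofReal_mul (by norm_num)
        simp_rw [this]
        rw [lintegral_const_mul _ (by fun_prop), lintegral_Ioc_rpow le_rfl (by positivity)
          (by norm_num), ← ENNReal.ofReal_mul (by norm_num)]
        refine ENNReal.ofReal_le_ofReal ?_
        have h8 : (8 : ℝ) ^ ((1 : ℝ) / 4) ≤ 2 :=
          (eight_rpow_le (n := (1 : ℕ)) (by norm_num)).trans (by rw [Real.rpow_natCast]; norm_num)
        rw [show (-(3 : ℝ) / 4 + 1) = 1 / 4 by norm_num, Real.zero_rpow (by norm_num),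
          Real.mul_rpow (by norm_num) (by positivity), ← Real.rpow_natCast k 2,
          ← Real.rpow_mul hk0.le]
        norm_num
        have h9 : 0 ≤ k ^ ((1 : ℝ) / 2) := Real.rpow_nonneg hk0.le _
        norm_num at h8 h9
        nlinarith
    _ = _ := by
        rw [← ENNReal.ofReal_mul (by positivity)]
        congr 1; ring

lemma lintegral_Ioc_zero_one_mul_gker_le {M : ℕ} (hM : 1 ≤ M) (c : ℝ) :
    ∫⁻ q in Set.Ioc 0 1, ENNReal.ofReal (q * gker M (c - q ^ 2) ^ ((5 : ℝ) / 4)) ≤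
      ENNReal.ofReal (100 * (M : ℝ) ^ ((1 : ℝ) / 4)) := by
  calc _ ≤ ∫⁻ q in Set.Ioi 0, ENNReal.ofReal (2 * q) *
          ((Set.Iic 1).indicator (fun u =>
            ENNReal.ofReal (gker M (c - u) ^ ((5 : ℝ) / 4))) (q ^ 2)) := by
        refine (setLIntegral_mono' measurableSet_Ioc fun q hq => ?_).trans
          (lintegral_mono_set Set.Ioc_subset_Ioi_self)
        have hq0 : 0 < q := hq.1
        have hqk : q ^ 2 ∈ Set.Iic (1 : ℝ) := pow_le_one₀ hq0.le hq.2
        simp only [Set.indicator_of_mem hqk]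
        rw [← ENNReal.ofReal_mul (by positivity)]
        have := Real.rpow_nonneg (gker_nonneg M (c - q ^ 2)) ((5 : ℝ) / 4)
        gcongr
        linarith
    _ = ∫⁻ u in Set.Ioi (0 ^ 2), (Set.Iic 1).indicator (fun u =>
            ENNReal.ofReal (gker M (c - u) ^ ((5 : ℝ) / 4))) u :=
        lintegral_Ioi_mul_comp_sq le_rfl _
    _ = ∫⁻ u in Set.Ioc 0 1, ENNReal.ofReal (gker M (c - u) ^ ((5 : ℝ) / 4)) := by
        rw [lintegral_indicator measurableSet_Iic, Measure.restrict_restrict measurableSet_Iic]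
        congr 2
        ext x; simp [and_comm]
    _ ≤ ∫⁻ u in Set.Ico (2 - 2 * Real.pi) 2, ENNReal.ofReal (gker M (c - u) ^ ((5 : ℝ) / 4)) := by
        refine lintegral_mono_set fun x hx => ⟨?_, ?_⟩
        · linarith [hx.1, Real.pi_gt_three]
        · linarith [hx.2]
    _ ≤ _ := lintegral_Ico_gker_const_sub_le hM c 2

lemma rpow_three_quarters_le {g q : ℝ} (hg : 0 ≤ g) (hq : 0 < q) :
    g ^ ((3 : ℝ) / 4) ≤ q * g ^ ((5 : ℝ) / 4) + q ^ (-(3 : ℝ) / 2) := by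
  by_cases h : g ≤ q ^ (-(2 : ℝ))
  · have h1 : g ^ ((3 : ℝ) / 4) ≤ (q ^ (-(2 : ℝ))) ^ ((3 : ℝ) / 4) :=
      Real.rpow_le_rpow hg h (by norm_num)
    rw [← Real.rpow_mul hq.le] at h1
    have h2 : 0 ≤ q * g ^ ((5 : ℝ) / 4) := by positivity
    norm_num at h1 h2 ⊢
    linarith
  · push Not at h
    have hg0 : 0 < g := lt_of_le_of_lt (by positivity) h
    have h1 : 1 ≤ q * g ^ ((1 : ℝ) / 2) := by
      have : (q ^ (-(2 : ℝ))) ^ ((1 : ℝ) / 2) ≤ g ^ ((1 : ℝ) / 2) :=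
        Real.rpow_le_rpow (by positivity) h.le (by norm_num)
      rw [← Real.rpow_mul hq.le] at this
      norm_num at this
      rw [Real.rpow_neg_one, inv_le_iff_one_le_mul₀' hq] at this
      norm_num
      exact this
    have h2 : g ^ ((5 : ℝ) / 4) = g ^ ((1 : ℝ) / 2) * g ^ ((3 : ℝ) / 4) := by
      rw [← Real.rpow_add hg0]; norm_num
    have h3 : 0 ≤ q ^ (-(3 : ℝ) / 2) := by positivity
    have h4 : 0 ≤ g ^ ((3 : ℝ) / 4) := by positivity
    rw [h2]
    nlinarith

lemma rpow_three_quarters_le_one_add {g : ℝ} (hg : 0 ≤ g) :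
    g ^ ((3 : ℝ) / 4) ≤ 1 + g ^ ((5 : ℝ) / 4) := by
  have := rpow_three_quarters_le hg one_pos
  simp at this
  linarith

lemma lintegral_Ioc_gker_mul_max_le {M : ℕ} (hM : 1 ≤ M) {k : ℝ} (hk : 1 < k) :
    ∫⁻ q in Set.Ioc 0 k,
      ENNReal.ofReal (gker M (k ^ 2 - q ^ 2) ^ ((3 : ℝ) / 4) * (max 1 q) ^ (-(1 : ℝ) / 2)) ≤
      ENNReal.ofReal (3400 * (M : ℝ) ^ ((1 : ℝ) / 4) * k ^ ((1 : ℝ) / 2)) := by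
  have hM' : (1 : ℝ) ≤ M := by exact_mod_cast hM
  have hM0 : (0 : ℝ) < M := by linarith
  set m : ℝ := (M : ℝ) ^ (-(1 : ℝ) / 2) with hm
  have hm0 : 0 < m := by positivity
  have hm1 : m ≤ 1 := Real.rpow_le_one_of_one_le_of_nonpos hM' (by norm_num)
  set G : ℝ → ENNReal := fun q =>
    ENNReal.ofReal (gker M (k ^ 2 - q ^ 2) ^ ((3 : ℝ) / 4) * (max 1 q) ^ (-(1 : ℝ) / 2)) with hG
  set X : ℝ := (M : ℝ) ^ ((1 : ℝ) / 4) with hX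
  have hX1 : 1 ≤ X := Real.one_le_rpow hM' (by norm_num)
  have b1 : ∫⁻ q in Set.Ioc 0 m, G q ≤ ENNReal.ofReal (2 * X) := by
    calc ∫⁻ q in Set.Ioc 0 m, G q
        ≤ ∫⁻ q in Set.Ioc 0 m, ENNReal.ofReal ((2 * M) ^ ((3 : ℝ) / 4)) := by
          refine setLIntegral_mono' measurableSet_Ioc fun q hq => ENNReal.ofReal_le_ofReal ?_
          rw [max_eq_left (hq.2.trans hm1), Real.one_rpow, mul_one]
          exact Real.rpow_le_rpow (gker_nonneg _ _) (gker_le _ _) (by norm_num)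
      _ = ENNReal.ofReal ((2 * M) ^ ((3 : ℝ) / 4) * m) := by
          rw [setLIntegral_const, Real.volume_Ioc, ← ENNReal.ofReal_mul (by positivity), sub_zero]
      _ ≤ _ := by
          refine ENNReal.ofReal_le_ofReal ?_
          rw [Real.mul_rpow (by norm_num) hM0.le, mul_assoc, hm, ← Real.rpow_add hM0, hX]
          have : (2 : ℝ) ^ ((3 : ℝ) / 4) ≤ 2 ^ (1 : ℝ) :=
            Real.rpow_le_rpow_of_exponent_le (by norm_num) (by norm_num)
          rw [Real.rpow_one] at this
          norm_num at this ⊢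
          gcongr
  have b2 : ∫⁻ q in Set.Ioc m 1, G q ≤ ENNReal.ofReal (102 * X) := by
    calc ∫⁻ q in Set.Ioc m 1, G q ≤ ∫⁻ q in Set.Ioc m 1,
          (ENNReal.ofReal (q * gker M (k ^ 2 - q ^ 2) ^ ((5 : ℝ) / 4)) +
            ENNReal.ofReal (q ^ (-(3 : ℝ) / 2))) := by
          refine setLIntegral_mono' measurableSet_Ioc fun q hq => ?_
          have hq0 := hm0.trans hq.1
          have hg := gker_nonneg M (k ^ 2 - q ^ 2)
          rw [← ENNReal.ofReal_add (by positivity) (by positivity)]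
          refine ENNReal.ofReal_le_ofReal ?_
          rw [max_eq_left hq.2, Real.one_rpow, mul_one]
          exact rpow_three_quarters_le hg hq0
      _ = (∫⁻ q in Set.Ioc m 1, ENNReal.ofReal (q * gker M (k ^ 2 - q ^ 2) ^ ((5 : ℝ) / 4))) +
            ∫⁻ q in Set.Ioc m 1, ENNReal.ofReal (q ^ (-(3 : ℝ) / 2)) :=
          lintegral_add_right _ (by fun_prop)
      _ ≤ ENNReal.ofReal (100 * X) + ENNReal.ofReal (2 * X) := by
          gcongr
          · exact (lintegral_mono_set (Set.Ioc_subset_Ioc_left hm0.le)).trans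
              (lintegral_Ioc_zero_one_mul_gker_le hM _)
          · refine (lintegral_mono_set Set.Ioc_subset_Ioi_self).trans (le_of_eq ?_)
            rw [lintegral_Ioi_rpow hm0 (by norm_num), hm, ← Real.rpow_mul hM0.le, hX]
            congr 1
            norm_num
            ring
      _ = _ := by
          rw [← ENNReal.ofReal_add (by positivity) (by positivity)]; ring_nf
  have b3 : ∫⁻ q in Set.Ioc 1 k, G q ≤
      ENNReal.ofReal (2 * k ^ ((1 : ℝ) / 2) + 3200 * X * k ^ ((1 : ℝ) / 2)) := by
    calc ∫⁻ q in Set.Ioc 1 k, G q ≤ ∫⁻ q in Set.Ioc 1 k, (ENNReal.ofReal (q ^ (-(1 : ℝ) / 2)) +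
            ENNReal.ofReal (gker M (k ^ 2 - q ^ 2) ^ ((5 : ℝ) / 4) * q ^ (-(1 : ℝ) / 2))) := by
          refine setLIntegral_mono' measurableSet_Ioc fun q hq => ?_
          have hq0 : 0 < q := lt_trans one_pos hq.1
          have hg := gker_nonneg M (k ^ 2 - q ^ 2)
          rw [← ENNReal.ofReal_add (by positivity) (by positivity)]
          refine ENNReal.ofReal_le_ofReal ?_
          rw [max_eq_right hq.1.le]
          have := rpow_three_quarters_le_one_add hg
          have h2 : 0 ≤ q ^ (-(1 : ℝ) / 2) := by positivity
          nlinarith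
      _ = (∫⁻ q in Set.Ioc 1 k, ENNReal.ofReal (q ^ (-(1 : ℝ) / 2))) +
          ∫⁻ q in Set.Ioc 1 k,
            ENNReal.ofReal (gker M (k ^ 2 - q ^ 2) ^ ((5 : ℝ) / 4) * q ^ (-(1 : ℝ) / 2)) :=
          lintegral_add_left (by fun_prop) _
      _ ≤ ENNReal.ofReal (2 * k ^ ((1 : ℝ) / 2)) +
          ENNReal.ofReal (3200 * X * k ^ ((1 : ℝ) / 2)) := by
          gcongr
          · rw [lintegral_Ioc_rpow zero_le_one hk.le (by norm_num)]
            refine ENNReal.ofReal_le_ofReal ?_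
            norm_num
            linarith
          · exact lintegral_Ioc_one_gker_mul_rpow_le hM _ hk.le
      _ = _ := by rw [← ENNReal.ofReal_add (by positivity) (by positivity)]
  have hk1 : 1 ≤ k ^ ((1 : ℝ) / 2) := Real.one_le_rpow hk.le (by norm_num)
  calc ∫⁻ q in Set.Ioc 0 k, G q
      ≤ ∫⁻ q in (Set.Ioc 0 m ∪ Set.Ioc m 1) ∪ Set.Ioc 1 k, G q := by
        refine lintegral_mono_set fun q hq => ?_
        rcases le_or_gt q m with h | h
        · exact Or.inl (Or.inl ⟨hq.1, h⟩)
        rcases le_or_gt q 1 with h' | h'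
        · exact Or.inl (Or.inr ⟨h, h'⟩)
        · exact Or.inr ⟨h', hq.2⟩
    _ ≤ (ENNReal.ofReal (2 * X) + ENNReal.ofReal (102 * X)) +
        ENNReal.ofReal (2 * k ^ ((1 : ℝ) / 2) + 3200 * X * k ^ ((1 : ℝ) / 2)) := by
        refine (lintegral_union_le _ _ _).trans (add_le_add ?_ b3)
        exact (lintegral_union_le _ _ _).trans (add_le_add b1 b2)
    _ = ENNReal.ofReal (2 * X + 102 * X +
          (2 * k ^ ((1 : ℝ) / 2) + 3200 * X * k ^ ((1 : ℝ) / 2))) := by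
        rw [ENNReal.ofReal_add (p := 2 * X + 102 * X) (by positivity) (by positivity),
          ENNReal.ofReal_add (p := 2 * X) (by positivity) (by positivity)]
    _ ≤ _ := by
        refine ENNReal.ofReal_le_ofReal ?_
        nlinarith

/-- The weight of the Schur test for the kernel `gker M (k² - q²) / max k q`. -/
def schurker (M : ℕ) (k q : ℝ) : ℝ :=
  if q ≤ k then
    if k ≤ 1 then 2 * (k ^ (-(1 : ℝ) / 2) * q ^ (-(1 : ℝ) / 2))
    else gker M (k ^ 2 - q ^ 2) ^ ((3 : ℝ) / 4) * (k ^ (-(1 : ℝ) / 2) * max 1 q ^ (-(1 : ℝ) / 2))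
  else
    if q ≤ 1 then 2 * (k ^ ((1 : ℝ) / 2) * q ^ (-(3 : ℝ) / 2))
    else gker M (k ^ 2 - q ^ 2) ^ ((5 : ℝ) / 4) * (q ^ (-(3 : ℝ) / 2) * max 1 k ^ ((1 : ℝ) / 2))

lemma measurable_schurker (M : ℕ) : Measurable fun p : ℝ × ℝ => schurker M p.1 p.2 := by
  have := (continuous_gker M).measurable
  unfold schurker
  refine Measurable.ite (measurableSet_le measurable_snd measurable_fst) ?_ ?_
  · exact Measurable.ite (measurableSet_le measurable_fst measurable_const)
      (by fun_prop) (by fun_prop)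
  · exact Measurable.ite (measurableSet_le measurable_snd measurable_const)
      (by fun_prop) (by fun_prop)

lemma schurker_nonneg (M : ℕ) {k q : ℝ} (hk : 0 < k) (hq : 0 < q) : 0 ≤ schurker M k q := by
  have := gker_nonneg M (k ^ 2 - q ^ 2)
  unfold schurker
  split_ifs <;> positivity

lemma lintegral_schurker_le {M : ℕ} (hM : 1 ≤ M) {k : ℝ} (hk : 0 < k) :
    ∫⁻ q in Set.Ioi 0, ENNReal.ofReal (schurker M k q) ≤
      ENNReal.ofReal (7000 * (M : ℝ) ^ ((1 : ℝ) / 4)) := by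
  have hM' : (1 : ℝ) ≤ M := by exact_mod_cast hM
  set X : ℝ := (M : ℝ) ^ ((1 : ℝ) / 4) with hX
  have hX1 : 1 ≤ X := Real.one_le_rpow hM' (by norm_num)
  rcases le_or_gt k 1 with hk1 | hk1
  · have b1 : ∫⁻ q in Set.Ioc 0 k, ENNReal.ofReal (schurker M k q) ≤ ENNReal.ofReal 4 := by
      calc _ = ∫⁻ q in Set.Ioc 0 k, ENNReal.ofReal (2 * k ^ (-(1 : ℝ) / 2)) *
            ENNReal.ofReal (q ^ (-(1 : ℝ) / 2)) := by
            refine setLIntegral_congr_fun measurableSet_Ioc fun q hq => ?_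
            rw [← ENNReal.ofReal_mul (by positivity), schurker, if_pos hq.2, if_pos hk1]
            ring_nf
        _ = _ := by
            rw [lintegral_const_mul _ (by fun_prop), lintegral_Ioc_rpow le_rfl hk.le (by norm_num),
              ← ENNReal.ofReal_mul (by positivity)]
            congr 1
            rw [Real.zero_rpow (by norm_num), mul_assoc, sub_zero, mul_div_assoc',
              ← Real.rpow_add hk]
            norm_num
        _ ≤ _ := le_rfl
    have b2 : ∫⁻ q in Set.Ioc k 1, ENNReal.ofReal (schurker M k q) ≤ ENNReal.ofReal 4 := by
      calc _ = ∫⁻ q in Set.Ioc k 1, ENNReal.ofReal (2 * k ^ ((1 : ℝ) / 2)) *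
            ENNReal.ofReal (q ^ (-(3 : ℝ) / 2)) := by
            refine setLIntegral_congr_fun measurableSet_Ioc fun q hq => ?_
            rw [← ENNReal.ofReal_mul (by positivity), schurker, if_neg (not_le.2 hq.1), if_pos hq.2]
            ring_nf
        _ ≤ ∫⁻ q in Set.Ioi k, ENNReal.ofReal (2 * k ^ ((1 : ℝ) / 2)) *
            ENNReal.ofReal (q ^ (-(3 : ℝ) / 2)) := lintegral_mono_set Set.Ioc_subset_Ioi_self
        _ = _ := by
            rw [lintegral_const_mul _ (by fun_prop), lintegral_Ioi_rpow hk (by norm_num),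
              ← ENNReal.ofReal_mul (by positivity)]
            congr 1
            rw [mul_assoc, mul_div_assoc', mul_neg, ← Real.rpow_add hk]
            norm_num
    have b3 : ∫⁻ q in Set.Ioi 1, ENNReal.ofReal (schurker M k q) ≤ ENNReal.ofReal (3200 * X) := by
      have := lintegral_Ioi_gker_mul_rpow_le hM (k ^ 2) (p := 1) le_rfl
      rw [Real.one_rpow, mul_one] at this
      refine le_trans (le_of_eq ?_) this
      refine setLIntegral_congr_fun measurableSet_Ioi fun q hq => ?_
      have hq1 : 1 < q := hq
      rw [schurker, if_neg (by linarith), if_neg (by linarith), max_eq_left hk1, Real.one_rpow,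
        mul_one]
    calc _ ≤ ∫⁻ q in (Set.Ioc 0 k ∪ Set.Ioc k 1) ∪ Set.Ioi 1, ENNReal.ofReal (schurker M k q) := by
          refine lintegral_mono_set fun q hq => ?_
          rcases le_or_gt q k with h | h
          · exact Or.inl (Or.inl ⟨hq, h⟩)
          rcases le_or_gt q 1 with h' | h'
          · exact Or.inl (Or.inr ⟨h, h'⟩)
          · exact Or.inr h'
      _ ≤ (ENNReal.ofReal 4 + ENNReal.ofReal 4) + ENNReal.ofReal (3200 * X) := by
          refine (lintegral_union_le _ _ _).trans (add_le_add ?_ b3)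
          exact (lintegral_union_le _ _ _).trans (add_le_add b1 b2)
      _ = ENNReal.ofReal (4 + 4 + 3200 * X) := by
          rw [ENNReal.ofReal_add (by norm_num) (by positivity), ENNReal.ofReal_add (by norm_num)
            (by norm_num)]
      _ ≤ _ := ENNReal.ofReal_le_ofReal (by linarith)
  · have b1 : ∫⁻ q in Set.Ioc 0 k, ENNReal.ofReal (schurker M k q) ≤ ENNReal.ofReal (3400 * X) := by
      calc _ = ∫⁻ q in Set.Ioc 0 k, ENNReal.ofReal (k ^ (-(1 : ℝ) / 2)) * ENNReal.ofReal
            (gker M (k ^ 2 - q ^ 2) ^ ((3 : ℝ) / 4) * (max 1 q) ^ (-(1 : ℝ) / 2)) := by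
            refine setLIntegral_congr_fun measurableSet_Ioc fun q hq => ?_
            rw [← ENNReal.ofReal_mul (by positivity), schurker, if_pos hq.2, if_neg (by linarith)]
            ring_nf
        _ ≤ ENNReal.ofReal (k ^ (-(1 : ℝ) / 2)) *
              ENNReal.ofReal (3400 * X * k ^ ((1 : ℝ) / 2)) := by
            rw [lintegral_const_mul' _ _ ENNReal.ofReal_ne_top]
            gcongr
            exact lintegral_Ioc_gker_mul_max_le hM hk1
        _ = _ := by
            rw [← ENNReal.ofReal_mul (by positivity)]
            congr 1
            rw [mul_left_comm, ← Real.rpow_add hk]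
            norm_num
    have b2 : ∫⁻ q in Set.Ioi k, ENNReal.ofReal (schurker M k q) ≤ ENNReal.ofReal (3200 * X) := by
      calc _ = ∫⁻ q in Set.Ioi k, ENNReal.ofReal (k ^ ((1 : ℝ) / 2)) * ENNReal.ofReal
            (gker M (k ^ 2 - q ^ 2) ^ ((5 : ℝ) / 4) * q ^ (-(3 : ℝ) / 2)) := by
            refine setLIntegral_congr_fun measurableSet_Ioi fun q hq => ?_
            have hq1 : k < q := hq
            rw [← ENNReal.ofReal_mul (by positivity), schurker, if_neg (by linarith),
              if_neg (by linarith), max_eq_right hk1.le]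
            ring_nf
        _ ≤ ENNReal.ofReal (k ^ ((1 : ℝ) / 2)) *
              ENNReal.ofReal (3200 * X * k ^ (-(1 : ℝ) / 2)) := by
            rw [lintegral_const_mul' _ _ ENNReal.ofReal_ne_top]
            gcongr
            exact lintegral_Ioi_gker_mul_rpow_le hM _ hk1.le
        _ = _ := by
            rw [← ENNReal.ofReal_mul (by positivity)]
            congr 1
            rw [mul_left_comm, ← Real.rpow_add hk]
            norm_num
    rw [← Set.Ioc_union_Ioi_eq_Ioi hk.le]
    calc _ ≤ ENNReal.ofReal (3400 * X) + ENNReal.ofReal (3200 * X) :=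
          (lintegral_union_le _ _ _).trans (add_le_add b1 b2)
      _ = ENNReal.ofReal (3400 * X + 3200 * X) := by
          rw [ENNReal.ofReal_add (by positivity) (by positivity)]
      _ ≤ _ := ENNReal.ofReal_le_ofReal (by linarith)

/-- The kernel of the difference between the backflow operator and a bounded operator. -/
def diffker (M : ℕ) (k q : ℝ) : ℝ :=
  (Real.sqrt k - Real.sqrt q) ^ 2 * |dker M (k ^ 2 - q ^ 2)|

lemma diffker_comm (M : ℕ) (k q : ℝ) : diffker M k q = diffker M q k := by
  unfold diffker
  rw [← dker_neg M (k ^ 2 - q ^ 2), neg_sub]; ring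

lemma diffker_nonneg (M : ℕ) (k q : ℝ) : 0 ≤ diffker M k q := by
  unfold diffker; positivity

lemma diffker_mul_le (M : ℕ) {k q : ℝ} (hq : 0 < q) (hqk : q ≤ k) :
    diffker M k q * k ≤ gker M (k ^ 2 - q ^ 2) := by
  have hk : 0 < k := hq.trans_le hqk
  have h1 : (Real.sqrt k - Real.sqrt q) ^ 2 ≤ k - q := by
    have a1 := Real.sq_sqrt hk.le
    have a2 := Real.sq_sqrt hq.le
    have a3 := Real.sqrt_le_sqrt hqk
    nlinarith [Real.sqrt_nonneg q]
  have h2 : (Real.sqrt k - Real.sqrt q) ^ 2 * k ≤ |k ^ 2 - q ^ 2| := by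
    refine le_trans ?_ (le_abs_self _)
    nlinarith [sub_nonneg.2 hqk]
  unfold diffker gker
  rw [abs_mul]
  nlinarith [abs_nonneg (dker M (k ^ 2 - q ^ 2))]

lemma diffker_sq_le_of_lt {M : ℕ} {k q : ℝ} (hq : 0 < q) (hqk : q < k) :
    diffker M k q ^ 2 ≤ schurker M k q * schurker M q k := by
  have hk : 0 < k := hq.trans hqk
  have hd := diffker_mul_le M hq hqk.le
  have hd0 := diffker_nonneg M k q
  have hg0 := gker_nonneg M (k ^ 2 - q ^ 2)
  have hgc : gker M (q ^ 2 - k ^ 2) = gker M (k ^ 2 - q ^ 2) := by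
    rw [← gker_neg, neg_sub]
  unfold schurker
  rw [if_pos hqk.le, if_neg (not_le.2 hqk), hgc]
  have hkk : k ^ (-(1 : ℝ) / 2) * k ^ (-(3 : ℝ) / 2) = (k ^ 2)⁻¹ := by
    rw [← Real.rpow_add hk, ← Real.rpow_natCast, ← Real.rpow_neg hk.le]; norm_num
  have inv_cancel : ∀ x : ℝ, 0 < x → x ^ (-(1 : ℝ) / 2) * x ^ ((1 : ℝ) / 2) = 1 := by
    intro x hx
    rw [← Real.rpow_add hx]; norm_num
  by_cases hk1 : k ≤ 1
  · rw [if_pos hk1, if_pos hk1]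
    have h2 : gker M (k ^ 2 - q ^ 2) ≤ 2 := gker_le_two (by
      rw [abs_le]; constructor <;> nlinarith)
    calc diffker M k q ^ 2 ≤ 4 * (k ^ 2)⁻¹ := by
          rw [← div_eq_mul_inv, le_div_iff₀ (by positivity), ← mul_pow]
          nlinarith [mul_nonneg hd0 hk.le]
      _ = 4 * ((k ^ (-(1 : ℝ) / 2) * k ^ (-(3 : ℝ) / 2)) *
            (q ^ (-(1 : ℝ) / 2) * q ^ ((1 : ℝ) / 2))) := by
          rw [hkk, inv_cancel q hq, mul_one]
      _ = _ := by ring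
  · rw [if_neg hk1, if_neg hk1]
    have h2 : gker M (k ^ 2 - q ^ 2) ^ ((3 : ℝ) / 4) * gker M (k ^ 2 - q ^ 2) ^ ((5 : ℝ) / 4) =
        gker M (k ^ 2 - q ^ 2) ^ 2 := by
      rw [← Real.rpow_add_of_nonneg hg0 (by norm_num) (by norm_num), ← Real.rpow_natCast]
      norm_num
    calc diffker M k q ^ 2 ≤ gker M (k ^ 2 - q ^ 2) ^ 2 * (k ^ 2)⁻¹ := by
          rw [← div_eq_mul_inv, le_div_iff₀ (by positivity), ← mul_pow]
          nlinarith [mul_nonneg hd0 hk.le]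
      _ = (gker M (k ^ 2 - q ^ 2) ^ ((3 : ℝ) / 4) * gker M (k ^ 2 - q ^ 2) ^ ((5 : ℝ) / 4)) *
          ((k ^ (-(1 : ℝ) / 2) * k ^ (-(3 : ℝ) / 2)) *
            (max 1 q ^ (-(1 : ℝ) / 2) * max 1 q ^ ((1 : ℝ) / 2))) := by
          rw [hkk, inv_cancel _ (lt_max_of_lt_left one_pos), mul_one, h2]
      _ = _ := by ring

lemma diffker_sq_le (M : ℕ) {k q : ℝ} (hk : 0 < k) (hq : 0 < q) :
    diffker M k q ^ 2 ≤ schurker M k q * schurker M q k := by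
  rcases lt_trichotomy q k with h | h | h
  · exact diffker_sq_le_of_lt hq h
  · subst h
    have : diffker M q q = 0 := by simp [diffker]
    rw [this]
    nlinarith [schurker_nonneg M hq hq]
  · rw [diffker_comm, mul_comm]
    exact diffker_sq_le_of_lt hk h

/-- Schur test for `diffker`. -/
lemma lintegral_lintegral_diffker_le {M : ℕ} (hM : 1 ≤ M) {u : ℝ → ℝ} (hu : Measurable u) :
    ∫⁻ k in Set.Ioi 0, ∫⁻ q in Set.Ioi 0, ENNReal.ofReal (u k * u q * diffker M k q) ≤
      ENNReal.ofReal (7000 * (M : ℝ) ^ ((1 : ℝ) / 4)) *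
        ∫⁻ k in Set.Ioi 0, ENNReal.ofReal (u k ^ 2) := by
  have hs := measurable_schurker M
  have hT : ∫⁻ k in Set.Ioi 0, ∫⁻ q in Set.Ioi 0,
      ENNReal.ofReal (u k ^ 2) * ENNReal.ofReal (schurker M k q) ≤
        ENNReal.ofReal (7000 * (M : ℝ) ^ ((1 : ℝ) / 4)) *
        ∫⁻ k in Set.Ioi 0, ENNReal.ofReal (u k ^ 2) := by
    rw [← lintegral_const_mul' _ _ ENNReal.ofReal_ne_top]
    refine setLIntegral_mono' measurableSet_Ioi fun k hk => ?_
    rw [lintegral_const_mul' _ _ ENNReal.ofReal_ne_top, mul_comm]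
    gcongr
    exact lintegral_schurker_le hM hk
  have hT' : ∫⁻ k in Set.Ioi 0, ∫⁻ q in Set.Ioi 0,
      ENNReal.ofReal (u q ^ 2) * ENNReal.ofReal (schurker M q k) =
      ∫⁻ k in Set.Ioi 0, ∫⁻ q in Set.Ioi 0,
      ENNReal.ofReal (u k ^ 2) * ENNReal.ofReal (schurker M k q) := by
    refine lintegral_lintegral_swap (Measurable.aemeasurable ?_)
    exact ((hu.comp measurable_snd).pow_const 2).ennreal_ofReal.mul
      (hs.comp measurable_swap).ennreal_ofReal
  have hpt : ∀ k ∈ Set.Ioi (0 : ℝ), ∀ q ∈ Set.Ioi (0 : ℝ),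
      2 * ENNReal.ofReal (u k * u q * diffker M k q) ≤
      ENNReal.ofReal (u k ^ 2) * ENNReal.ofReal (schurker M k q) +
        ENNReal.ofReal (u q ^ 2) * ENNReal.ofReal (schurker M q k) := by
    intro k hk q hq
    have h1 := schurker_nonneg M hk hq
    have h2 := schurker_nonneg M hq hk
    have h3 := diffker_sq_le M hk hq
    have h4 := diffker_nonneg M k q
    rw [← ENNReal.ofReal_mul (by positivity), ← ENNReal.ofReal_mul (by positivity),
      ← ENNReal.ofReal_add (by positivity) (by positivity),
      show (2 : ENNReal) = ENNReal.ofReal 2 by simp, ← ENNReal.ofReal_mul (by norm_num)]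
    refine ENNReal.ofReal_le_ofReal ?_
    refine abs_le_of_sq_le_sq' ?_ (by positivity) |>.2
    have h5 : (u k * u q) ^ 2 * diffker M k q ^ 2 ≤
      (u k * u q) ^ 2 * (schurker M k q * schurker M q k) := by gcongr
    nlinarith [sq_nonneg (u k ^ 2 * schurker M k q - u q ^ 2 * schurker M q k)]
  have h2 : 2 * ∫⁻ k in Set.Ioi 0, ∫⁻ q in Set.Ioi 0,
      ENNReal.ofReal (u k * u q * diffker M k q) ≤
      2 * (ENNReal.ofReal (7000 * (M : ℝ) ^ ((1 : ℝ) / 4)) *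
        ∫⁻ k in Set.Ioi 0, ENNReal.ofReal (u k ^ 2)) := by
    calc _ = ∫⁻ k in Set.Ioi 0, ∫⁻ q in Set.Ioi 0,
          2 * ENNReal.ofReal (u k * u q * diffker M k q) := by
          rw [← lintegral_const_mul' _ _ (by norm_num)]
          refine lintegral_congr fun k => ?_
          rw [lintegral_const_mul' _ _ (by norm_num)]
      _ ≤ ∫⁻ k in Set.Ioi 0, ∫⁻ q in Set.Ioi 0,
          (ENNReal.ofReal (u k ^ 2) * ENNReal.ofReal (schurker M k q) +
          ENNReal.ofReal (u q ^ 2) * ENNReal.ofReal (schurker M q k)) :=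
          setLIntegral_mono' measurableSet_Ioi fun k hk =>
            setLIntegral_mono' measurableSet_Ioi fun q hq => hpt k hk q hq
      _ = (∫⁻ k in Set.Ioi 0, ∫⁻ q in Set.Ioi 0,
            ENNReal.ofReal (u k ^ 2) * ENNReal.ofReal (schurker M k q)) +
          ∫⁻ k in Set.Ioi 0, ∫⁻ q in Set.Ioi 0,
            ENNReal.ofReal (u q ^ 2) * ENNReal.ofReal (schurker M q k) := by
          have hm : Measurable fun p : ℝ × ℝ =>
              ENNReal.ofReal (u p.1 ^ 2) * ENNReal.ofReal (schurker M p.1 p.2) := by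
            fun_prop
          rw [← lintegral_add_left hm.lintegral_prod_right']
          refine lintegral_congr fun k => ?_
          exact lintegral_add_left (hm.comp measurable_prodMk_left) _
      _ ≤ _ := by rw [hT', two_mul]; gcongr
  exact (ENNReal.mul_le_mul_iff_right (by norm_num) (by norm_num)).1 h2

/-- Bounded measurable functions supported in a bounded subset of the half-line. -/
structure Nice (A : ℝ) (φ : ℝ → ℂ) : Prop where
  meas : Measurable φ
  bdd : ∀ k, ‖φ k‖ ≤ A
  zero : ∀ k, k ∉ Set.Ioo 0 A → φ k = 0

lemma Nice.integrable {A : ℝ} {φ : ℝ → ℂ} (h : Nice A φ) : Integrable φ := by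
  have : φ = Set.indicator (Set.Ioo 0 A) φ := by
    ext k
    by_cases hk : k ∈ Set.Ioo 0 A
    · simp [hk]
    · simp [hk, h.zero k hk]
  rw [this, integrable_indicator_iff measurableSet_Ioo]
  exact Measure.integrableOn_of_bounded (M := A) (by simp) h.meas.aestronglyMeasurable
    (Eventually.of_forall h.bdd)

lemma Nice.zero_of_nonpos {A : ℝ} {φ : ℝ → ℂ} (h : Nice A φ) {k : ℝ} (hk : k ≤ 0) :
    φ k = 0 :=
  h.zero k fun hk' => absurd hk'.1 (not_lt.2 hk)

/-- The unnormalised wave function at position `x` and time `t`. -/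
def wave (φ : ℝ → ℂ) (t x : ℝ) : ℂ :=
  ∫ k : ℝ, Complex.exp (Complex.I * x * k) * (Complex.exp (-Complex.I * (k : ℂ) ^ 2 * t) * φ k)

lemma norm_exp_I_mul (x k : ℝ) : ‖Complex.exp (Complex.I * x * k)‖ = 1 := by
  rw [show Complex.I * x * k = ((x * k : ℝ) : ℂ) * Complex.I by push_cast; ring]
  exact Complex.norm_exp_ofReal_mul_I _

lemma norm_exp_neg_I_mul_sq (t k : ℝ) : ‖Complex.exp (-Complex.I * (k : ℂ) ^ 2 * t)‖ = 1 := by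
  rw [show -Complex.I * (k : ℂ) ^ 2 * t = ((-k ^ 2 * t : ℝ) : ℂ) * Complex.I by push_cast; ring]
  exact Complex.norm_exp_ofReal_mul_I _

lemma Nice.integrable_wave {A : ℝ} {φ : ℝ → ℂ} (h : Nice A φ) (t x : ℝ) :
    Integrable fun k : ℝ =>
      Complex.exp (Complex.I * x * k) * (Complex.exp (-Complex.I * (k : ℂ) ^ 2 * t) * φ k) := by
  refine h.integrable.mono ?_ (Eventually.of_forall fun k => ?_)
  · have := h.meas
    exact Measurable.aestronglyMeasurable (by fun_prop)
  · rw [norm_mul, norm_mul, norm_exp_I_mul, norm_exp_neg_I_mul_sq, one_mul, one_mul]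

lemma two_pi_rpow_mul_self :
    ((2 * Real.pi) ^ (-(1/2) : ℝ)) * ((2 * Real.pi) ^ (-(1/2) : ℝ)) = 1 / (2 * Real.pi) := by
  rw [← Real.rpow_add (by positivity)]
  norm_num
  rw [Real.rpow_neg_one]
  field_simp

section

variable {S : ℝ → Hp →L[ℂ] Hp} {R : Hp →L[ℂ] HL} {Pm : HL →L[ℂ] HL}

lemma Nice.R_S_ae {A : ℝ} {φ : ℝ → ℂ} (h : Nice A φ) (hs : Setup S R Pm) {Φ : Hp}
    (hΦ : Φ =ᵐ[μp] φ) (t : ℝ) :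
    (R (S t Φ) : ℝ → ℂ) =ᵐ[volume]
      fun x => (((2 * Real.pi) ^ (-(1/2) : ℝ) : ℝ) : ℂ) * wave φ t x := by
  have h1 : (S t Φ : ℝ → ℂ) =ᵐ[μp]
      fun k => Complex.exp (-Complex.I * (k : ℂ) ^ 2 * t) * φ k := by
    filter_upwards [hs.hS t Φ, hΦ] with k h1 h2
    rw [h1, h2]
  have h2 : Integrable (S t Φ : ℝ → ℂ) μp := by
    have h3 := (h.integrable_wave t 0).integrableOn (s := Set.Ioi (0 : ℝ))
    simp only [Complex.ofReal_zero, mul_zero, zero_mul, Complex.exp_zero, one_mul] at h3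
    exact (integrable_congr h1).2 h3
  filter_upwards [hs.hR _ h2] with x hx
  rw [hx, wave]
  congr 1
  refine Eq.trans (integral_congr_ae ?_)
    (setIntegral_eq_integral_of_forall_compl_eq_zero (s := Set.Ioi (0 : ℝ)) fun k hk => ?_)
  · filter_upwards [h1] with k hk
    rw [hk]
  · rw [h.zero_of_nonpos (not_lt.1 hk)]
    simp

lemma Nice.integrable_wave_sq {A : ℝ} {φ : ℝ → ℂ} (h : Nice A φ) (hs : Setup S R Pm) {Φ : Hp}
    (hΦ : Φ =ᵐ[μp] φ) (t : ℝ) : Integrable fun x => ‖wave φ t x‖ ^ 2 := by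
  have h1 := (memLp_two_iff_integrable_sq_norm (Lp.aestronglyMeasurable (R (S t Φ)))).1
    (Lp.memLp (R (S t Φ)))
  have h2 : Integrable fun x => (2 * Real.pi) * ‖(R (S t Φ) : ℝ → ℂ) x‖ ^ 2 := h1.const_mul _
  refine (integrable_congr ?_).1 h2
  filter_upwards [h.R_S_ae hs hΦ t] with x hx
  rw [hx, norm_mul, mul_pow, Complex.norm_real, Real.norm_eq_abs, sq_abs, sq, two_pi_rpow_mul_self]
  field_simp

lemma Nice.inner_eq {A : ℝ} {φ : ℝ → ℂ} (h : Nice A φ) (hs : Setup S R Pm) {Φ : Hp}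
    (hΦ : Φ =ᵐ[μp] φ) (t : ℝ) :
    inner ℂ Φ (((ContinuousLinearMap.adjoint (S t)).comp ((ContinuousLinearMap.adjoint R).comp
      (Pm.comp (R.comp (S t))))) Φ) =
      (((1 / (2 * Real.pi)) * ∫ x in Set.Iio (0 : ℝ), ‖wave φ t x‖ ^ 2 : ℝ) : ℂ) := by
  simp only [ContinuousLinearMap.comp_apply, ContinuousLinearMap.adjoint_inner_right]
  rw [L2.inner_def, ← integral_const_mul, ← integral_complex_ofReal,
    ← integral_indicator measurableSet_Iio]
  refine integral_congr_ae ?_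
  filter_upwards [hs.hPm (R (S t Φ)), h.R_S_ae hs hΦ t] with x h1 h2
  rw [h1]
  by_cases hx : x ∈ Set.Iio (0 : ℝ)
  · rw [Set.indicator_of_mem hx, Set.indicator_of_mem hx, h2, inner_self_eq_norm_sq_to_K, norm_mul,
      Complex.norm_real, Real.norm_eq_abs, ← two_pi_rpow_mul_self]
    rw [abs_of_pos (by positivity)]
    push_cast
    simp only [Complex.coe_algebraMap]
    ring
  · rw [Set.indicator_of_notMem hx, Set.indicator_of_notMem hx, inner_zero_right]

end

lemma sum_sin_eq_zero (M : ℕ) (ω : ℝ) :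
    ∑ j ∈ Finset.range M, Real.sin (ω * (2 * j + 1 - M)) = 0 := by
  have h := Finset.sum_range_reflect (fun j : ℕ => Real.sin (ω * (2 * j + 1 - M))) M
  have h2 : ∑ j ∈ Finset.range M, Real.sin (ω * (2 * ((M - 1 - j : ℕ) : ℝ) + 1 - M)) =
      -∑ j ∈ Finset.range M, Real.sin (ω * (2 * j + 1 - M)) := by
    rw [← Finset.sum_neg_distrib]
    refine Finset.sum_congr rfl fun j hj => ?_
    have hj' := Finset.mem_range.1 hj
    rw [← Real.sin_neg, Nat.cast_sub (by omega), Nat.cast_sub (by omega)]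
    congr 1
    push_cast
    ring
  linarith

lemma sum_exp_eq (M : ℕ) (ω : ℝ) :
    ∑ j ∈ Finset.range M, Complex.exp (Complex.I * (ω * (2 * j + 1 - M) : ℝ)) =
      ((∑ j ∈ Finset.range M, Real.cos (ω * (2 * j + 1 - M)) : ℝ) : ℂ) := by
  have h : ∀ x : ℝ, Complex.exp (Complex.I * x) =
      (Real.cos x : ℂ) + (Real.sin x : ℂ) * Complex.I := by
    intro x
    rw [mul_comm, Complex.exp_mul_I]
    push_cast
    rfl
  simp only [h]
  rw [Finset.sum_add_distrib, ← Finset.sum_mul, ← Complex.ofReal_sum, ← Complex.ofReal_sum,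
    sum_sin_eq_zero]
  simp

lemma sum_exp_sub_exp (M : ℕ) (ω : ℝ) :
    ∑ j ∈ Finset.range M, (Complex.exp (Complex.I * (ω * (2 * j + 1 - M + 1 / 2) : ℝ)) -
      Complex.exp (Complex.I * (ω * (2 * j + 1 - M - 1 / 2) : ℝ))) =
      Complex.I * (ω * dker M ω : ℝ) := by
  have h : ∀ j : ℕ, Complex.exp (Complex.I * (ω * (2 * j + 1 - M + 1 / 2) : ℝ)) -
      Complex.exp (Complex.I * (ω * (2 * j + 1 - M - 1 / 2) : ℝ)) =
      2 * Complex.I * (Real.sin (ω / 2) : ℂ) *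
        Complex.exp (Complex.I * (ω * (2 * j + 1 - M) : ℝ)) := by
    intro j
    have h1 : Complex.I * (ω * (2 * j + 1 - M + 1 / 2) : ℝ) =
      Complex.I * (ω * (2 * j + 1 - M) : ℝ) + ((ω / 2 : ℝ) : ℂ) * Complex.I := by push_cast; ring
    have h2 : Complex.I * (ω * (2 * j + 1 - M - 1 / 2) : ℝ) =
      Complex.I * (ω * (2 * j + 1 - M) : ℝ) + ((-(ω / 2) : ℝ) : ℂ) * Complex.I := by
      push_cast; ring
    rw [h1, h2, Complex.exp_add, Complex.exp_add, Complex.exp_mul_I, Complex.exp_mul_I]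
    rw [← Complex.ofReal_cos, ← Complex.ofReal_sin, ← Complex.ofReal_cos, ← Complex.ofReal_sin,
      Real.cos_neg, Real.sin_neg]
    push_cast
    ring
  simp only [h]
  rw [← Finset.mul_sum, sum_exp_eq, dker, ← mul_assoc, mul_sinc_half]
  push_cast
  ring

/-- The product density `conj φ(k) φ(q)`. -/
def pairing (φ : ℝ → ℂ) (p : ℝ × ℝ) : ℂ := (starRingEnd ℂ) (φ p.1) * φ p.2

lemma Nice.integrable_pairing {A : ℝ} {φ : ℝ → ℂ} (h : Nice A φ) :
    Integrable (pairing φ) (volume.prod volume) :=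
  Integrable.mul_prod (f := fun k => (starRingEnd ℂ) (φ k))
    (Complex.conjCLE.integrable_comp_iff.2 h.integrable) h.integrable

lemma Nice.measurable_pairing {A : ℝ} {φ : ℝ → ℂ} (h : Nice A φ) : Measurable (pairing φ) := by
  have := h.meas
  unfold pairing
  fun_prop

lemma wave_sq (φ : ℝ → ℂ) (t x : ℝ) :
    ((‖wave φ t x‖ ^ 2 : ℝ) : ℂ) = ∫ p : ℝ × ℝ, pairing φ p *
      Complex.exp (Complex.I * ((p.1 ^ 2 - p.2 ^ 2) * t : ℝ)) *
      Complex.exp (Complex.I * (p.2 - p.1) * x) ∂(volume.prod volume) := by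
  rw [Complex.ofReal_pow, ← Complex.conj_mul', wave, ← integral_conj, ← integral_prod_mul]
  refine integral_congr_ae (Eventually.of_forall fun p => ?_)
  simp only [pairing, map_mul, ← Complex.exp_conj, map_neg, Complex.conj_I, Complex.conj_ofReal,
    map_pow]
  calc _ = (starRingEnd ℂ) (φ p.1) * φ p.2 *
      (Complex.exp (-Complex.I * x * p.1) * Complex.exp (- -Complex.I * (p.1 : ℂ) ^ 2 * t) *
        Complex.exp (Complex.I * x * p.2) * Complex.exp (-Complex.I * (p.2 : ℂ) ^ 2 * t)) := by ring
    _ = _ := by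
      rw [← Complex.exp_add, ← Complex.exp_add, ← Complex.exp_add,
        mul_assoc ((starRingEnd ℂ) (φ p.1) * φ p.2) (Complex.exp _) (Complex.exp _),
        ← Complex.exp_add]
      congr 2
      push_cast
      ring

lemma norm_exp_I_mul_ofReal (x : ℝ) : ‖Complex.exp (Complex.I * x)‖ = 1 := by
  rw [mul_comm]; exact Complex.norm_exp_ofReal_mul_I x

lemma Nice.integral_damped {A : ℝ} {φ : ℝ → ℂ} (h : Nice A φ) (t : ℝ) {ε : ℝ} (hε : 0 < ε) :
    ((∫ x in Set.Iio (0 : ℝ), Real.exp (ε * x) * ‖wave φ t x‖ ^ 2 : ℝ) : ℂ) =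
      ∫ p : ℝ × ℝ, pairing φ p * Complex.exp (Complex.I * ((p.1 ^ 2 - p.2 ^ 2) * t : ℝ)) /
        (ε + Complex.I * (p.2 - p.1)) ∂(volume.prod volume) := by
  have hm := h.measurable_pairing
  have h1 : ∀ x : ℝ, ((Real.exp (ε * x) * ‖wave φ t x‖ ^ 2 : ℝ) : ℂ) =
      ∫ p : ℝ × ℝ, pairing φ p *
      Complex.exp (Complex.I * ((p.1 ^ 2 - p.2 ^ 2) * t : ℝ)) *
      Complex.exp ((ε + Complex.I * (p.2 - p.1)) * x) ∂(volume.prod volume) := by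
    intro x
    rw [Complex.ofReal_mul, wave_sq φ t x, ← integral_const_mul]
    refine integral_congr_ae (Eventually.of_forall fun p => ?_)
    simp only
    rw [add_mul, Complex.exp_add]
    push_cast
    ring
  rw [← integral_complex_ofReal, ← integral_Iic_eq_integral_Iio]
  simp only [h1]
  rw [integral_integral_swap]
  · refine integral_congr_ae (Eventually.of_forall fun p => ?_)
    simp only
    rw [integral_const_mul, integral_exp_mul_complex_Iic (by simpa using hε)]
    simp [div_eq_mul_inv]
  · have h2 : Integrable (fun z : ℝ × (ℝ × ℝ) => (Real.exp (ε * z.1) : ℂ) * pairing φ z.2)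
        ((volume.restrict (Set.Iic 0)).prod (volume.prod volume)) :=
      Integrable.mul_prod (f := fun x : ℝ => (Real.exp (ε * x) : ℂ))
        (integrableOn_exp_mul_Iic hε 0).ofReal h.integrable_pairing
    refine h2.mono ?_ (Eventually.of_forall fun z => ?_)
    · refine Measurable.aestronglyMeasurable ?_
      unfold Function.uncurry
      fun_prop
    · simp only [Function.uncurry]
      rw [add_mul, Complex.exp_add, norm_mul, norm_mul, norm_mul, norm_mul, norm_exp_I_mul_ofReal,
        show Complex.I * ((z.2.2 : ℂ) - z.2.1) * z.1 =
          Complex.I * (((z.2.2 - z.2.1) * z.1 : ℝ) : ℂ) by push_cast; ring,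
        norm_exp_I_mul_ofReal, ← Complex.ofReal_mul, ← Complex.ofReal_exp]
      rw [mul_one, mul_one, mul_comm]

lemma tendsto_integral_damped {f : ℝ → ℝ} (hf : Integrable f) :
    Tendsto (fun n : ℕ => ∫ x in Set.Iio (0 : ℝ), Real.exp ((1 / ((n : ℝ) + 1)) * x) * f x) atTop
      (nhds (∫ x in Set.Iio (0 : ℝ), f x)) := by
  refine tendsto_integral_of_dominated_convergence (fun x => ‖f x‖) (fun n => ?_)
    hf.norm.integrableOn (fun n => ?_) ?_
  · exact (by fun_prop : Continuous fun x : ℝ =>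
      Real.exp ((1 / ((n : ℝ) + 1)) * x)).aestronglyMeasurable.mul
      hf.aestronglyMeasurable.restrict
  · filter_upwards [ae_restrict_mem measurableSet_Iio] with x hx
    rw [norm_mul, Real.norm_eq_abs, Real.abs_exp]
    refine mul_le_of_le_one_left (norm_nonneg _) (Real.exp_le_one_iff.2 ?_)
    exact mul_nonpos_of_nonneg_of_nonpos (by positivity) (le_of_lt hx)
  · refine Eventually.of_forall fun x => ?_
    have h1 : Tendsto (fun n : ℕ => Real.exp ((1 / ((n : ℝ) + 1)) * x) * f x) atTop
        (nhds (Real.exp (0 * x) * f x)) :=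
      ((Real.continuous_exp.tendsto _).comp
        (tendsto_one_div_add_atTop_nhds_zero_nat.mul_const x)).mul_const _
    simpa using h1

lemma ae_fst_ne_snd : ∀ᵐ p : ℝ × ℝ ∂(volume.prod volume), p.1 ≠ p.2 := by
  rw [ae_iff]
  simp only [ne_eq, not_not]
  rw [Measure.measure_prod_null (measurableSet_eq_fun measurable_fst measurable_snd)]
  refine Eventually.of_forall fun x => ?_
  simp only [Set.preimage_ofPred_eq, Pi.zero_apply]
  simp

/-- The kernel of the quadratic form of `BM S R Pm M (tMlist M)`, up to the factor `-1 / (2 π)`. -/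
def formKernel (M : ℕ) (p : ℝ × ℝ) : ℝ := (p.1 + p.2) * dker M (p.1 ^ 2 - p.2 ^ 2)

lemma continuous_formKernel (M : ℕ) : Continuous (formKernel M) := by
  have := continuous_dker M
  unfold formKernel
  fun_prop

lemma Nice.norm_pairing_mul_le {A : ℝ} {φ : ℝ → ℂ} (h : Nice A φ) {M : ℕ} (p : ℝ × ℝ) :
    ‖pairing φ p‖ * |formKernel M p| ≤ ‖pairing φ p‖ * (2 * A * M) := by
  by_cases h1 : p.1 ∈ Set.Ioo 0 A
  · by_cases h2 : p.2 ∈ Set.Ioo 0 A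
    · gcongr
      rw [formKernel, abs_mul]
      have h3 := abs_dker_le M (p.1 ^ 2 - p.2 ^ 2)
      have h4 : |p.1 + p.2| ≤ 2 * A := by
        rw [abs_le]; constructor <;> linarith [h1.1, h1.2, h2.1, h2.2]
      exact mul_le_mul h4 h3 (abs_nonneg _) ((abs_nonneg _).trans h4)
    · simp [pairing, h.zero _ h2]
  · simp [pairing, h.zero _ h1]

lemma Nice.integrable_pairing_mul {A : ℝ} {φ : ℝ → ℂ} (h : Nice A φ) (M : ℕ) :
    Integrable (fun p => pairing φ p * formKernel M p) (volume.prod volume) := by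
  refine (h.integrable_pairing.norm.mul_const (2 * A * M)).mono' ?_
    (Eventually.of_forall fun p => ?_)
  · have := h.measurable_pairing
    have := (continuous_formKernel M).measurable
    exact Measurable.aestronglyMeasurable (by fun_prop)
  · rw [norm_mul, Complex.norm_real]
    exact h.norm_pairing_mul_le p

lemma le_norm_add_I_mul (ε s : ℝ) : |s| ≤ ‖(ε : ℂ) + Complex.I * s‖ := by
  have := Complex.abs_im_le_norm ((ε : ℂ) + Complex.I * s)
  simpa using this

lemma Nice.tendsto_damped {A : ℝ} {φ : ℝ → ℂ} (h : Nice A φ) (M : ℕ) :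
    Tendsto (fun n : ℕ => ∫ p : ℝ × ℝ, pairing φ p * (Complex.I * ((p.1 ^ 2 - p.2 ^ 2) *
        dker M (p.1 ^ 2 - p.2 ^ 2) : ℝ)) /
        (((1 / ((n : ℝ) + 1) : ℝ) : ℂ) + Complex.I * (p.2 - p.1)) ∂(volume.prod volume)) atTop
      (nhds (∫ p : ℝ × ℝ, -(pairing φ p * formKernel M p) ∂(volume.prod volume))) := by
  have hm := h.measurable_pairing
  have hd := (continuous_dker M).measurable
  refine tendsto_integral_of_dominated_convergence (fun p => ‖pairing φ p‖ * (2 * A * M))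
    (fun n => Measurable.aestronglyMeasurable (by fun_prop))
    (h.integrable_pairing.norm.mul_const (2 * A * M)) (fun n => ?_) ?_
  · refine Eventually.of_forall fun p => le_trans ?_ (h.norm_pairing_mul_le (M := M) p)
    rw [mul_div_assoc, norm_mul]
    gcongr
    rw [norm_div, norm_mul, Complex.norm_I, one_mul, Complex.norm_real, Real.norm_eq_abs]
    refine div_le_of_le_mul₀ (norm_nonneg _) (abs_nonneg _) ?_
    have h1 := le_norm_add_I_mul (1 / ((n : ℝ) + 1)) (p.2 - p.1)
    rw [show (p.1 ^ 2 - p.2 ^ 2) * dker M (p.1 ^ 2 - p.2 ^ 2) =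
      formKernel M p * (-(p.2 - p.1)) by rw [formKernel]; ring, abs_mul, abs_neg]
    push_cast at h1 ⊢
    gcongr
  · filter_upwards [ae_fst_ne_snd] with p hp
    have hp' : (p.2 : ℂ) - p.1 ≠ 0 := by
      rw [sub_ne_zero]; exact_mod_cast hp.symm
    have h1 : Tendsto (fun n : ℕ => (((1 / ((n : ℝ) + 1) : ℝ) : ℂ) + Complex.I * (p.2 - p.1))) atTop
        (nhds (((0 : ℝ) : ℂ) + Complex.I * (p.2 - p.1))) :=
      ((Complex.continuous_ofReal.tendsto _).comp
        tendsto_one_div_add_atTop_nhds_zero_nat).add_const _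
    have h2 := (tendsto_const_nhds (x := pairing φ p * (Complex.I * ((p.1 ^ 2 - p.2 ^ 2) *
        dker M (p.1 ^ 2 - p.2 ^ 2) : ℝ)))).div h1 (by simpa using hp')
    convert h2 using 2
    · rfl
    rw [formKernel]
    have := Complex.I_ne_zero
    push_cast
    rw [zero_add]
    field_simp
    ring

section

variable {S : ℝ → Hp →L[ℂ] Hp} {R : Hp →L[ℂ] HL} {Pm : HL →L[ℂ] HL}

lemma tMlist_even (M : ℕ) (j : Fin M) (h) :
    tMlist M ⟨2 * j.1, h⟩ = 2 * (j : ℝ) + 1 - M - 1 / 2 := by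
  simp only [tMlist]; push_cast; ring

lemma tMlist_odd (M : ℕ) (j : Fin M) (h) :
    tMlist M ⟨2 * j.1 + 1, h⟩ = 2 * (j : ℝ) + 1 - M + 1 / 2 := by
  simp only [tMlist]; push_cast; ring

lemma Nice.inner_BM_eq {A : ℝ} {φ : ℝ → ℂ} (h : Nice A φ) (hs : Setup S R Pm) {Φ : Hp}
    (hΦ : Φ =ᵐ[μp] φ) (M : ℕ) :
    inner ℂ Φ (BM S R Pm M (tMlist M) Φ) =
      -(1 / (2 * Real.pi)) * ∫ p : ℝ × ℝ, pairing φ p * formKernel M p ∂(volume.prod volume) := by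
  have hInt := fun t => h.integrable_wave_sq hs hΦ t
  have h1 : inner ℂ Φ (BM S R Pm M (tMlist M) Φ) =
      (((1 / (2 * Real.pi)) * ∑ j ∈ Finset.range M,
        ((∫ x in Set.Iio (0 : ℝ), ‖wave φ (2 * (j : ℝ) + 1 - M + 1 / 2) x‖ ^ 2) -
        ∫ x in Set.Iio (0 : ℝ), ‖wave φ (2 * (j : ℝ) + 1 - M - 1 / 2) x‖ ^ 2) : ℝ) : ℂ) := by
    rw [BM, sum_apply, inner_sum, ← Fin.sum_univ_eq_sum_range
      (fun j : ℕ => ((∫ x in Set.Iio (0 : ℝ), ‖wave φ (2 * (j : ℝ) + 1 - M + 1 / 2) x‖ ^ 2) -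
        ∫ x in Set.Iio (0 : ℝ), ‖wave φ (2 * (j : ℝ) + 1 - M - 1 / 2) x‖ ^ 2)), Finset.mul_sum,
      Complex.ofReal_sum]
    refine Finset.sum_congr rfl fun j _ => ?_
    rw [B1, sub_apply, inner_sub_right, h.inner_eq hs hΦ, h.inner_eq hs hΦ,
      tMlist_even, tMlist_odd]
    push_cast
    ring
  have h2 : Tendsto (fun n : ℕ => ((∑ j ∈ Finset.range M,
        ((∫ x in Set.Iio (0 : ℝ), Real.exp ((1 / ((n : ℝ) + 1)) * x) *
          ‖wave φ (2 * (j : ℝ) + 1 - M + 1 / 2) x‖ ^ 2) -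
        ∫ x in Set.Iio (0 : ℝ), Real.exp ((1 / ((n : ℝ) + 1)) * x) *
          ‖wave φ (2 * (j : ℝ) + 1 - M - 1 / 2) x‖ ^ 2) : ℝ) : ℂ)) atTop
      (nhds ((∑ j ∈ Finset.range M,
        ((∫ x in Set.Iio (0 : ℝ), ‖wave φ (2 * (j : ℝ) + 1 - M + 1 / 2) x‖ ^ 2) -
        ∫ x in Set.Iio (0 : ℝ), ‖wave φ (2 * (j : ℝ) + 1 - M - 1 / 2) x‖ ^ 2) : ℝ) : ℂ)) :=
    (Complex.continuous_ofReal.tendsto _).comp (tendsto_finsetSum _ fun j _ =>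
      (tendsto_integral_damped (hInt _)).sub (tendsto_integral_damped (hInt _)))
  have hm := h.measurable_pairing
  have hi : ∀ (n : ℕ) (t : ℝ), Integrable (fun p : ℝ × ℝ => pairing φ p *
      Complex.exp (Complex.I * ((p.1 ^ 2 - p.2 ^ 2) * t : ℝ)) /
        (((1 / ((n : ℝ) + 1) : ℝ) : ℂ) + Complex.I * (p.2 - p.1))) (volume.prod volume) := by
    intro n t
    refine (h.integrable_pairing.norm.mul_const ((n : ℝ) + 1)).mono'
      (Measurable.aestronglyMeasurable (by fun_prop)) (Eventually.of_forall fun p => ?_)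
    rw [norm_div, norm_mul, norm_exp_I_mul_ofReal, mul_one, div_eq_mul_inv]
    gcongr
    have h3 := Complex.abs_re_le_norm (((1 / ((n : ℝ) + 1) : ℝ) : ℂ) + Complex.I * (p.2 - p.1))
    have h4 : (((1 / ((n : ℝ) + 1) : ℝ) : ℂ) + Complex.I * (p.2 - p.1)).re = 1 / ((n : ℝ) + 1) := by
      rw [Complex.add_re, Complex.ofReal_re]
      simp
    rw [h4, abs_of_pos (by positivity)] at h3
    exact inv_le_of_inv_le₀ (by positivity) (by simpa using h3)
  have h3 : (fun n : ℕ => ((∑ j ∈ Finset.range M,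
        ((∫ x in Set.Iio (0 : ℝ), Real.exp ((1 / ((n : ℝ) + 1)) * x) *
          ‖wave φ (2 * (j : ℝ) + 1 - M + 1 / 2) x‖ ^ 2) -
        ∫ x in Set.Iio (0 : ℝ), Real.exp ((1 / ((n : ℝ) + 1)) * x) *
          ‖wave φ (2 * (j : ℝ) + 1 - M - 1 / 2) x‖ ^ 2) : ℝ) : ℂ)) =
      fun n : ℕ => ∫ p : ℝ × ℝ, pairing φ p * (Complex.I * ((p.1 ^ 2 - p.2 ^ 2) *
        dker M (p.1 ^ 2 - p.2 ^ 2) : ℝ)) /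
        (((1 / ((n : ℝ) + 1) : ℝ) : ℂ) + Complex.I * (p.2 - p.1)) ∂(volume.prod volume) := by
    ext n
    have hn : (0 : ℝ) < 1 / ((n : ℝ) + 1) := by positivity
    rw [Complex.ofReal_sum]
    simp only [Complex.ofReal_sub]
    simp only [h.integral_damped _ hn]
    rw [Finset.sum_congr rfl fun j _ => (integral_sub (hi n _) (hi n _)).symm]
    refine (integral_finsetSum _ fun j _ => (hi n _).sub (hi n _)).symm.trans ?_
    refine integral_congr_ae (Eventually.of_forall fun p => ?_)
    simp only
    rw [← sum_exp_sub_exp, Finset.mul_sum, Finset.sum_div]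
    refine Finset.sum_congr rfl fun j _ => ?_
    simp only [Pi.sub_apply]
    ring
  rw [h3] at h2
  have h5 := tendsto_nhds_unique h2 (h.tendsto_damped M)
  rw [h1, Complex.ofReal_mul, h5, integral_neg]
  push_cast
  ring

end

lemma integral_Ioi_comp_sq {E : Type*} [NormedAddCommGroup E] [NormedSpace ℝ E] (g : ℝ → E) :
    ∫ x in Set.Ioi (0 : ℝ), (2 * x) • g (x ^ 2) = ∫ y in Set.Ioi (0 : ℝ), g y := by
  rw [← integral_comp_rpow_Ioi g (two_ne_zero)]
  refine setIntegral_congr_fun measurableSet_Ioi fun x _ => ?_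
  norm_num

lemma integrableOn_Ioi_comp_sq_iff {E : Type*} [NormedAddCommGroup E] [NormedSpace ℝ E]
    (g : ℝ → E) :
    IntegrableOn (fun x : ℝ => (2 * x) • g (x ^ 2)) (Set.Ioi 0) ↔ IntegrableOn g (Set.Ioi 0) := by
  rw [← integrableOn_Ioi_comp_rpow_iff g (two_ne_zero)]
  refine integrableOn_congr_fun (fun x _ => ?_) measurableSet_Ioi
  norm_num

lemma norm_sq_eq_integral {μ : Measure ℝ} (Φ : Lp ℂ 2 μ) : ‖Φ‖ ^ 2 = ∫ x, ‖Φ x‖ ^ 2 ∂μ := by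
  have h := inner_self_eq_norm_sq_to_K (𝕜 := ℂ) Φ
  rw [L2.inner_def] at h
  have h2 : ∫ x, inner ℂ (Φ x) (Φ x) ∂μ = ((∫ x, ‖Φ x‖ ^ 2 ∂μ : ℝ) : ℂ) := by
    rw [← integral_complex_ofReal]
    refine integral_congr_ae (Eventually.of_forall fun x => ?_)
    simp only [inner_self_eq_norm_sq_to_K]
    push_cast
    rfl
  rw [h2] at h
  simp only [Complex.coe_algebraMap] at h
  exact_mod_cast h.symm

/-- The weight `√(2 * k)` turning `L²(dk)` into `L²` in the energy variable. -/
def weighted (φ : ℝ → ℂ) (k : ℝ) : ℂ := (Real.sqrt (2 * k) : ℂ) * φ k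

lemma Nice.mono {A A' : ℝ} {φ : ℝ → ℂ} (h : Nice A φ) (hA : A ≤ A') : Nice A' φ :=
  ⟨h.meas, fun k => (h.bdd k).trans hA, fun k hk => h.zero k fun hk' =>
    hk ⟨hk'.1, hk'.2.trans_le hA⟩⟩

lemma Nice.exists_weighted {A : ℝ} {φ : ℝ → ℂ} (h : Nice A φ) : ∃ A', Nice A' (weighted φ) := by
  refine ⟨max A (Real.sqrt (2 * A) * A), ?_, fun k => ?_, fun k hk => ?_⟩
  · have := h.meas
    unfold weighted
    fun_prop
  · by_cases hk : k ∈ Set.Ioo 0 A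
    · refine le_max_of_le_right ?_
      rw [weighted, norm_mul, Complex.norm_real, Real.norm_eq_abs,
        abs_of_nonneg (Real.sqrt_nonneg _)]
      have h1 := h.bdd k
      have h2 := hk.2.le
      gcongr
    · rw [weighted, h.zero k hk, mul_zero, norm_zero]
      exact le_max_of_le_left ((norm_nonneg _).trans (h.bdd 0))
  · rw [weighted, h.zero k fun hk' => hk ⟨hk'.1, hk'.2.trans_le (le_max_left _ _)⟩, mul_zero]

/-- The wave packet in the energy variable `E = k²`. -/
def energy (φ : ℝ → ℂ) (E : ℝ) : ℂ := weighted φ (Real.sqrt E) / (2 * Real.sqrt E : ℝ)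

lemma two_mul_smul_energy_sq (φ : ℝ → ℂ) {q : ℝ} (hq : 0 < q) :
    ((2 * q : ℝ) : ℂ) * energy φ (q ^ 2) = weighted φ q := by
  rw [energy, Real.sqrt_sq hq.le, mul_div_cancel₀]
  exact_mod_cast (by positivity : 2 * q ≠ 0)

lemma two_mul_norm_energy_sq (φ : ℝ → ℂ) {q : ℝ} (hq : 0 < q) :
    2 * q * ‖energy φ (q ^ 2)‖ ^ 2 = ‖φ q‖ ^ 2 := by
  have hs := Real.sq_sqrt (by positivity : 0 ≤ 2 * q)
  have h1 : ‖((2 * q : ℝ) : ℂ) * energy φ (q ^ 2)‖ ^ 2 = ‖weighted φ q‖ ^ 2 := by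
    rw [two_mul_smul_energy_sq φ hq]
  rw [weighted, norm_mul, norm_mul, Complex.norm_real, Complex.norm_real, Real.norm_eq_abs,
    Real.norm_eq_abs, mul_pow, mul_pow, sq_abs, sq_abs, hs] at h1
  have h2 : 2 * q * (2 * q * ‖energy φ (q ^ 2)‖ ^ 2) = 2 * q * ‖φ q‖ ^ 2 := by
    rw [← h1]; ring
  exact mul_left_cancel₀ (by positivity) h2

lemma Nice.measurable_energy {A : ℝ} {φ : ℝ → ℂ} (h : Nice A φ) : Measurable (energy φ) := by
  have := h.meas
  unfold energy weighted
  fun_prop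

lemma Nice.integrable_sq {A : ℝ} {φ : ℝ → ℂ} (h : Nice A φ) : Integrable fun k => ‖φ k‖ ^ 2 := by
  refine (h.integrable.norm.const_mul A).mono' (h.meas.norm.pow_const 2).aestronglyMeasurable
    (Eventually.of_forall fun k => ?_)
  rw [norm_pow, norm_norm, sq]
  exact mul_le_mul_of_nonneg_right (h.bdd k) (norm_nonneg _)

lemma Nice.integrableOn_energy_sq {A : ℝ} {φ : ℝ → ℂ} (h : Nice A φ) :
    IntegrableOn (fun E => ‖energy φ E‖ ^ 2) (Set.Ioi 0) := by
  rw [← integrableOn_Ioi_comp_sq_iff]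
  refine (integrableOn_congr_fun (fun q hq => ?_) measurableSet_Ioi).1 h.integrable_sq.integrableOn
  exact (two_mul_norm_energy_sq φ hq).symm

lemma integral_energy_sq (φ : ℝ → ℂ) :
    ∫ E in Set.Ioi (0 : ℝ), ‖energy φ E‖ ^ 2 = ∫ k in Set.Ioi (0 : ℝ), ‖φ k‖ ^ 2 := by
  rw [← integral_Ioi_comp_sq]
  refine setIntegral_congr_fun measurableSet_Ioi fun q hq => ?_
  exact two_mul_norm_energy_sq φ hq

lemma Nice.integrableOn_energy {A : ℝ} {φ : ℝ → ℂ} (h : Nice A φ) :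
    IntegrableOn (energy φ) (Set.Ioi 0) := by
  obtain ⟨A', h'⟩ := h.exists_weighted
  rw [← integrableOn_Ioi_comp_sq_iff]
  refine (integrableOn_congr_fun (fun q hq => ?_) measurableSet_Ioi).1 h'.integrable.integrableOn
  rw [Complex.real_smul, two_mul_smul_energy_sq φ hq]

lemma Nice.integral_exp_mul_energy {A : ℝ} {φ : ℝ → ℂ} (h : Nice A φ) (x : ℝ) :
    ∫ E in Set.Ioi (0 : ℝ), Complex.exp (Complex.I * x * E) * energy φ E =
      wave (weighted φ) (-x) 0 := by
  obtain ⟨A', h'⟩ := h.exists_weighted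
  rw [← integral_Ioi_comp_sq, wave]
  refine Eq.trans ?_ (setIntegral_eq_integral_of_forall_compl_eq_zero
    (s := Set.Ioi (0 : ℝ)) (fun k hk => by rw [h'.zero_of_nonpos (not_lt.1 hk)]; simp))
  refine setIntegral_congr_fun measurableSet_Ioi fun q hq => ?_
  rw [Complex.real_smul, mul_left_comm, two_mul_smul_energy_sq φ hq]
  simp only [Complex.ofReal_zero, mul_zero, zero_mul, Complex.exp_zero, one_mul]
  congr 2
  push_cast
  ring

section

variable {S : ℝ → Hp →L[ℂ] Hp} {R : Hp →L[ℂ] HL} {Pm : HL →L[ℂ] HL}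

lemma Nice.plancherel {A : ℝ} {φ : ℝ → ℂ} (h : Nice A φ) (hs : Setup S R Pm) :
    Integrable (fun t => ‖wave (weighted φ) t 0‖ ^ 2) ∧
      ∫ t, ‖wave (weighted φ) t 0‖ ^ 2 =
        2 * Real.pi * ∫ k in Set.Ioi (0 : ℝ), ‖φ k‖ ^ 2 := by
  have hmem : MemLp (energy φ) 2 μp :=
    (memLp_two_iff_integrable_sq_norm h.measurable_energy.aestronglyMeasurable).2
      h.integrableOn_energy_sq
  set Ψ : Hp := hmem.toLp with hΨ
  have hc : (Ψ : ℝ → ℂ) =ᵐ[μp] energy φ := hmem.coeFn_toLp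
  have hR : (R Ψ : ℝ → ℂ) =ᵐ[volume]
      fun x => (((2 * Real.pi) ^ (-(1/2) : ℝ) : ℝ) : ℂ) * wave (weighted φ) (-x) 0 := by
    filter_upwards [hs.hR Ψ ((integrable_congr hc).2 h.integrableOn_energy)] with x hx
    rw [hx, ← h.integral_exp_mul_energy]
    congr 1
    refine integral_congr_ae ?_
    filter_upwards [hc] with k hk
    rw [hk]
  have hR2 : (fun x => ‖(R Ψ : ℝ → ℂ) x‖ ^ 2) =ᵐ[volume]
      fun x => 1 / (2 * Real.pi) * ‖wave (weighted φ) (-x) 0‖ ^ 2 := by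
    filter_upwards [hR] with x hx
    rw [hx, norm_mul, mul_pow, Complex.norm_real, Real.norm_eq_abs, sq_abs, sq,
      two_pi_rpow_mul_self]
  have hInt := (memLp_two_iff_integrable_sq_norm (Lp.aestronglyMeasurable (R Ψ))).1
    (Lp.memLp (R Ψ))
  have hnorm : ‖R Ψ‖ ^ 2 = ‖Ψ‖ ^ 2 := by rw [hs.hR_isometry]
  rw [norm_sq_eq_integral, norm_sq_eq_integral, integral_congr_ae hR2, integral_const_mul,
    integral_neg_eq_self (fun x => ‖wave (weighted φ) x 0‖ ^ 2)] at hnorm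
  have hΨ2 : ∫ x, ‖Ψ x‖ ^ 2 ∂μp = ∫ k in Set.Ioi (0 : ℝ), ‖φ k‖ ^ 2 := by
    rw [← integral_energy_sq φ]
    refine integral_congr_ae ?_
    filter_upwards [hc] with k hk
    rw [hk]
  have hpi := Real.pi_pos
  constructor
  · have h1 := ((integrable_congr hR2).1 hInt).const_mul (2 * Real.pi)
    have h2 := h1.comp_neg
    refine h2.congr (Eventually.of_forall fun x => ?_)
    simp only [neg_neg]
    field_simp
  · rw [← hΨ2, ← hnorm]
    field_simp

end

/-- The backflow interval number `j` of the equally spaced list. -/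
def slot (M j : ℕ) : Set ℝ := Set.Ioc (2 * (j : ℝ) + 1 - M - 1 / 2) (2 * (j : ℝ) + 1 - M + 1 / 2)

lemma pairwise_disjoint_slot (M : ℕ) (s : Set ℕ) :
    s.Pairwise (Function.onFun Disjoint (slot M)) := by
  intro i _ j _ hij
  rw [Function.onFun, Set.disjoint_left]
  intro x hi hj
  rcases lt_or_gt_of_ne hij with h | h
  · have : (i : ℝ) + 1 ≤ j := by exact_mod_cast h
    linarith [hi.2, hj.1]
  · have : (j : ℝ) + 1 ≤ i := by exact_mod_cast h
    linarith [hj.2, hi.1]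

lemma dker_eq_sum_integral (M : ℕ) (ω : ℝ) :
    (dker M ω : ℂ) = ∑ j ∈ Finset.range M,
      ∫ t in slot M j, Complex.exp (Complex.I * (ω * t : ℝ)) := by
  have h0 : ∀ j : ℕ, ∫ t in slot M j, Complex.exp (Complex.I * (ω * t : ℝ)) =
      ∫ t in (2 * (j : ℝ) + 1 - M - 1 / 2)..(2 * (j : ℝ) + 1 - M + 1 / 2),
        Complex.exp (Complex.I * ω * t) := by
    intro j
    rw [intervalIntegral.integral_of_le (by linarith), slot]
    refine integral_congr_ae (Eventually.of_forall fun t => ?_)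
    simp only
    congr 1
    push_cast
    ring
  simp only [h0]
  by_cases hω : ω = 0
  · subst hω
    simp [dker]
    ring
  · have hc : Complex.I * ω ≠ 0 := mul_ne_zero Complex.I_ne_zero (by exact_mod_cast hω)
    simp only [integral_exp_mul_complex hc]
    rw [← Finset.sum_div, eq_div_iff hc]
    have h1 := sum_exp_sub_exp M ω
    have h2 : (dker M ω : ℂ) * (Complex.I * ω) = Complex.I * (ω * dker M ω : ℝ) := by
      push_cast; ring
    rw [h2, ← h1]
    refine Finset.sum_congr rfl fun j _ => ?_
    congr 2 <;> (push_cast; ring)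

lemma Nice.integral_pairing_dker {A : ℝ} {h : ℝ → ℂ} (hh : Nice A h) (M : ℕ) :
    ∫ p : ℝ × ℝ, pairing h p * dker M (p.1 ^ 2 - p.2 ^ 2) ∂(volume.prod volume) =
      ((∑ j ∈ Finset.range M, ∫ t in slot M j, ‖wave h t 0‖ ^ 2 : ℝ) : ℂ) := by
  have hm := hh.measurable_pairing
  have hi : ∀ j, Integrable (Function.uncurry fun (t : ℝ) (p : ℝ × ℝ) =>
      pairing h p * Complex.exp (Complex.I * ((p.1 ^ 2 - p.2 ^ 2) * t : ℝ)))
      ((volume.restrict (slot M j)).prod (volume.prod volume)) := by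
    intro j
    have h1 : Integrable (fun z : ℝ × (ℝ × ℝ) => (1 : ℂ) * pairing h z.2)
        ((volume.restrict (slot M j)).prod (volume.prod volume)) :=
      Integrable.mul_prod (f := fun _ : ℝ => (1 : ℂ))
        (integrableOn_const (by simp [slot])) hh.integrable_pairing
    refine h1.mono ?_ (Eventually.of_forall fun z => ?_)
    · refine Measurable.aestronglyMeasurable ?_
      unfold Function.uncurry
      fun_prop
    · simp only [Function.uncurry]
      rw [norm_mul, norm_exp_I_mul_ofReal, mul_one, one_mul]
  have h2 : ∀ t : ℝ, ((‖wave h t 0‖ ^ 2 : ℝ) : ℂ) = ∫ p : ℝ × ℝ, pairing h p *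
      Complex.exp (Complex.I * ((p.1 ^ 2 - p.2 ^ 2) * t : ℝ)) ∂(volume.prod volume) := by
    intro t
    rw [wave_sq]
    simp
  rw [Complex.ofReal_sum]
  simp only [← integral_complex_ofReal, h2]
  rw [Finset.sum_congr rfl fun j _ => integral_integral_swap (hi j)]
  refine Eq.trans ?_ (integral_finsetSum _ fun j _ => (hi j).integral_prod_right)
  refine integral_congr_ae (Eventually.of_forall fun p => ?_)
  simp only
  rw [dker_eq_sum_integral, Finset.mul_sum]
  refine Finset.sum_congr rfl fun j _ => ?_
  rw [integral_const_mul]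

section

variable {S : ℝ → Hp →L[ℂ] Hp} {R : Hp →L[ℂ] HL} {Pm : HL →L[ℂ] HL}

lemma Nice.norm_integral_weighted_le {A : ℝ} {φ : ℝ → ℂ} (h : Nice A φ) (hs : Setup S R Pm)
    (M : ℕ) :
    ‖∫ p : ℝ × ℝ, pairing (weighted φ) p * dker M (p.1 ^ 2 - p.2 ^ 2) ∂(volume.prod volume)‖ ≤
      2 * Real.pi * ∫ k in Set.Ioi (0 : ℝ), ‖φ k‖ ^ 2 := by
  obtain ⟨A', h'⟩ := h.exists_weighted
  obtain ⟨hInt, heq⟩ := h.plancherel hs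
  rw [h'.integral_pairing_dker, Complex.norm_real, Real.norm_eq_abs, abs_of_nonneg
    (Finset.sum_nonneg fun j _ => integral_nonneg fun t => by positivity),
    ← integral_biUnion_finset _ (s := slot M) (fun _ _ => measurableSet_Ioc)
      (pairwise_disjoint_slot M _)
      (fun _ _ => hInt.integrableOn), ← heq]
  exact setIntegral_le_integral hInt (Eventually.of_forall fun t => by positivity)

lemma Nice.norm_integral_diffker_le {A : ℝ} {φ : ℝ → ℂ} (h : Nice A φ) {M : ℕ} (hM : 1 ≤ M) :
    ‖∫ p : ℝ × ℝ, pairing φ p * (((Real.sqrt p.1 - Real.sqrt p.2) ^ 2 *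
      dker M (p.1 ^ 2 - p.2 ^ 2) : ℝ) : ℂ) ∂(volume.prod volume)‖ ≤
      7000 * (M : ℝ) ^ ((1 : ℝ) / 4) * ∫ k in Set.Ioi (0 : ℝ), ‖φ k‖ ^ 2 := by
  have hm := h.measurable_pairing
  have hφ := h.meas
  have hd := (continuous_dker M).measurable
  set G : ℝ × ℝ → ℂ := fun p => pairing φ p * (((Real.sqrt p.1 - Real.sqrt p.2) ^ 2 *
      dker M (p.1 ^ 2 - p.2 ^ 2) : ℝ) : ℂ) with hG
  have hI : 0 ≤ ∫ k in Set.Ioi (0 : ℝ), ‖φ k‖ ^ 2 := integral_nonneg fun _ => by positivity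
  have hGm : Measurable fun p => ‖G p‖ₑ := by
    rw [hG]
    fun_prop
  have hpt : ∀ k q, ‖G (k, q)‖ₑ = ENNReal.ofReal (‖φ k‖ * ‖φ q‖ * diffker M k q) := by
    intro k q
    rw [← ofReal_norm, hG]
    simp only [pairing, norm_mul, RCLike.norm_conj, Complex.norm_real, Real.norm_eq_abs, diffker,
      abs_of_nonneg (sq_nonneg (Real.sqrt k - Real.sqrt q))]
  have hres : ∀ F : ℝ → ENNReal, (∀ k, k ∉ Set.Ioi (0 : ℝ) → F k = 0) →
      ∫⁻ k, F k = ∫⁻ k in Set.Ioi (0 : ℝ), F k := by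
    intro F hF
    rw [← lintegral_indicator measurableSet_Ioi]
    refine lintegral_congr fun k => ?_
    by_cases hk : k ∈ Set.Ioi (0 : ℝ)
    · rw [Set.indicator_of_mem hk]
    · rw [Set.indicator_of_notMem hk, hF k hk]
  have key : ENNReal.ofReal ‖∫ p, G p ∂(volume.prod volume)‖ ≤
      ENNReal.ofReal (7000 * (M : ℝ) ^ ((1 : ℝ) / 4) * ∫ k in Set.Ioi (0 : ℝ), ‖φ k‖ ^ 2) := by
    rw [ENNReal.ofReal_mul (by positivity), ofReal_norm,
      ofReal_integral_eq_lintegral_ofReal h.integrable_sq.integrableOn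
        (Eventually.of_forall fun k => by positivity)]
    refine (enorm_integral_le_lintegral_enorm _).trans ?_
    refine le_trans (le_of_eq ?_) (lintegral_lintegral_diffker_le hM hφ.norm)
    rw [lintegral_prod _ hGm.aemeasurable]
    simp only [hpt]
    rw [hres]
    · refine setLIntegral_congr_fun measurableSet_Ioi fun k _ => ?_
      rw [hres]
      intro q hq
      simp [h.zero_of_nonpos (not_lt.1 hq)]
    · intro k hk
      simp [h.zero_of_nonpos (not_lt.1 hk)]
  exact (ENNReal.ofReal_le_ofReal_iff (by positivity)).1 key

lemma Nice.norm_inner_BM_le {A : ℝ} {φ : ℝ → ℂ} (h : Nice A φ) (hs : Setup S R Pm) {Φ : Hp}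
    (hΦ : Φ =ᵐ[μp] φ) {M : ℕ} (hM : 1 ≤ M) :
    ‖inner ℂ Φ (BM S R Pm M (tMlist M) Φ)‖ ≤ 7007 * (M : ℝ) ^ ((1 : ℝ) / 4) * ‖Φ‖ ^ 2 := by
  obtain ⟨A', h'⟩ := h.exists_weighted
  have hm := h.measurable_pairing
  have hd := (continuous_dker M).measurable
  have e1 : ∀ p, pairing φ p * formKernel M p =
      pairing (weighted φ) p * dker M (p.1 ^ 2 - p.2 ^ 2) +
      pairing φ p * (((Real.sqrt p.1 - Real.sqrt p.2) ^ 2 *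
      dker M (p.1 ^ 2 - p.2 ^ 2) : ℝ) : ℂ) := by
    intro p
    by_cases h1 : 0 < p.1
    · by_cases h2 : 0 < p.2
      · have e2 : Real.sqrt (2 * p.1) * Real.sqrt (2 * p.2) =
            2 * (Real.sqrt p.1 * Real.sqrt p.2) := by
          rw [Real.sqrt_mul (by norm_num), Real.sqrt_mul (by norm_num)]
          linear_combination Real.sqrt p.1 * Real.sqrt p.2 *
            Real.mul_self_sqrt (show (0 : ℝ) ≤ 2 by norm_num)
        have e3 : p.1 + p.2 = Real.sqrt (2 * p.1) * Real.sqrt (2 * p.2) +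
            (Real.sqrt p.1 - Real.sqrt p.2) ^ 2 := by
          rw [e2]
          nlinarith [Real.mul_self_sqrt h1.le, Real.mul_self_sqrt h2.le]
        rw [formKernel, e3]
        simp only [pairing, weighted, map_mul, Complex.conj_ofReal]
        push_cast
        ring
      · simp [pairing, weighted, h.zero_of_nonpos (not_lt.1 h2)]
    · simp [pairing, weighted, h.zero_of_nonpos (not_lt.1 h1)]
  have i1 : Integrable (fun p : ℝ × ℝ => pairing (weighted φ) p * dker M (p.1 ^ 2 - p.2 ^ 2))
      (volume.prod volume) := by
    have := h'.measurable_pairing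
    refine (h'.integrable_pairing.norm.mul_const (M : ℝ)).mono'
      (Measurable.aestronglyMeasurable (by fun_prop)) (Eventually.of_forall fun p => ?_)
    rw [norm_mul, Complex.norm_real]
    exact mul_le_mul_of_nonneg_left (abs_dker_le _ _) (norm_nonneg _)
  have i2 : Integrable (fun p : ℝ × ℝ => pairing φ p * (((Real.sqrt p.1 - Real.sqrt p.2) ^ 2 *
      dker M (p.1 ^ 2 - p.2 ^ 2) : ℝ) : ℂ)) (volume.prod volume) := by
    refine ((h.integrable_pairing_mul M).sub i1).congr (Eventually.of_forall fun p => ?_)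
    simp only [Pi.sub_apply, e1]
    ring
  have hn : ‖Φ‖ ^ 2 = ∫ k in Set.Ioi (0 : ℝ), ‖φ k‖ ^ 2 := by
    rw [norm_sq_eq_integral]
    refine integral_congr_ae ?_
    filter_upwards [hΦ] with k hk
    rw [hk]
  have b1 := h.norm_integral_weighted_le hs M
  have b2 := h.norm_integral_diffker_le hM
  have hpi := Real.pi_pos
  have hpi3 := Real.pi_gt_three
  have hX : (1 : ℝ) ≤ (M : ℝ) ^ ((1 : ℝ) / 4) :=
    Real.one_le_rpow (by exact_mod_cast hM) (by norm_num)
  rw [h.inner_BM_eq hs hΦ M, hn]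
  simp only [e1]
  rw [integral_add i1 i2, norm_mul]
  have b3 := (norm_add_le _ _).trans (add_le_add b1 b2)
  have e4 : ‖-(1 / (2 * (Real.pi : ℂ)))‖ = 1 / (2 * Real.pi) := by
    rw [norm_neg, norm_div, norm_mul]
    simp [abs_of_pos hpi]
  rw [e4]
  set I := ∫ k in Set.Ioi (0 : ℝ), ‖φ k‖ ^ 2
  have hI : 0 ≤ I := integral_nonneg fun _ => by positivity
  refine (mul_le_mul_of_nonneg_left b3 (by positivity)).trans ?_
  rw [div_mul_eq_mul_div, div_le_iff₀ (by positivity)]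
  set X := (M : ℝ) ^ ((1 : ℝ) / 4)
  have hXI : I ≤ X * I := le_mul_of_one_le_left hI hX
  have h6 : 0 ≤ X * I := by positivity
  nlinarith [mul_le_mul_of_nonneg_left hXI hpi.le, mul_nonneg h6 hpi.le,
    mul_nonneg h6 (sub_nonneg.2 hpi3.le)]

end

section Abstract

variable {H : Type*} [NormedAddCommGroup H] [InnerProductSpace ℂ H]

lemma re_inner_algebraMap (c : ℝ) (x : H) :
    RCLike.re (inner ℂ (algebraMap ℝ (H →L[ℂ] H) c x) x) = c * ‖x‖ ^ 2 := by
  rw [Algebra.algebraMap_eq_smul_one, smul_apply, one_apply_eq_self,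
    inner_smul_left_eq_smul, RCLike.re_eq_complex_re,
    Complex.smul_re, ← RCLike.re_eq_complex_re, inner_self_eq_norm_sq, smul_eq_mul]

variable [CompleteSpace H]

lemma isSelfAdjoint_algebraMap (c : ℝ) : IsSelfAdjoint (algebraMap ℝ (H →L[ℂ] H) c) :=
  (IsSelfAdjoint.all c).algebraMap _

lemma le_iff_forall_re_inner {T U : H →L[ℂ] H} (hT : IsSelfAdjoint T) (hU : IsSelfAdjoint U) :
    T ≤ U ↔ ∀ x, RCLike.re (inner ℂ (T x) x) ≤ RCLike.re (inner ℂ (U x) x) := by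
  rw [ContinuousLinearMap.le_def, ContinuousLinearMap.isPositive_def]
  have h1 := ContinuousLinearMap.isSelfAdjoint_iff_isSymmetric.1 (hU.sub hT)
  simp only [h1, true_and, ContinuousLinearMap.reApplyInnerSelf_apply, sub_apply, inner_sub_left,
    map_sub, sub_nonneg]

lemma forall_spectrum_le_iff {T : H →L[ℂ] H} (hT : IsSelfAdjoint T) (c : ℝ) :
    (∀ r ∈ spectrum ℝ T, r ≤ c) ↔ ∀ x, RCLike.re (inner ℂ (T x) x) ≤ c * ‖x‖ ^ 2 := by
  rw [← le_algebraMap_iff_spectrum_le hT, le_iff_forall_re_inner hT (isSelfAdjoint_algebraMap c)]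
  simp only [re_inner_algebraMap]

lemma forall_le_spectrum_iff {T : H →L[ℂ] H} (hT : IsSelfAdjoint T) (c : ℝ) :
    (∀ r ∈ spectrum ℝ T, c ≤ r) ↔ ∀ x, c * ‖x‖ ^ 2 ≤ RCLike.re (inner ℂ (T x) x) := by
  rw [← algebraMap_le_iff_le_spectrum hT, le_iff_forall_re_inner (isSelfAdjoint_algebraMap c) hT]
  simp only [re_inner_algebraMap]

lemma le_sSup_spectrum {T : H →L[ℂ] H} (hT : IsSelfAdjoint T) {c C : ℝ}
    (hC : ∀ x, RCLike.re (inner ℂ (T x) x) ≤ C * ‖x‖ ^ 2) {x : H} (hx : x ≠ 0)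
    (hc : c * ‖x‖ ^ 2 ≤ RCLike.re (inner ℂ (T x) x)) : c ≤ sSup (spectrum ℝ T) := by
  have h1 := (forall_spectrum_le_iff hT _).1 (fun r hr =>
    le_csSup ⟨C, (forall_spectrum_le_iff hT C).2 hC⟩ hr) x
  have h2 : 0 < ‖x‖ ^ 2 := by positivity
  exact le_of_mul_le_mul_right (hc.trans h1) h2

lemma sInf_spectrum_le {T : H →L[ℂ] H} (hT : IsSelfAdjoint T) {c C : ℝ}
    (hC : ∀ x, C * ‖x‖ ^ 2 ≤ RCLike.re (inner ℂ (T x) x)) {x : H} (hx : x ≠ 0)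
    (hc : RCLike.re (inner ℂ (T x) x) ≤ c * ‖x‖ ^ 2) : sInf (spectrum ℝ T) ≤ c := by
  have h1 := (forall_le_spectrum_iff hT _).1 (fun r hr =>
    csInf_le ⟨C, (forall_le_spectrum_iff hT C).2 hC⟩ hr) x
  have h2 : 0 < ‖x‖ ^ 2 := by positivity
  exact le_of_mul_le_mul_right (h1.trans hc) h2

end Abstract

lemma Nice.memLp {A : ℝ} {φ : ℝ → ℂ} (h : Nice A φ) : MemLp φ 2 μp :=
  (memLp_two_iff_integrable_sq_norm h.meas.aestronglyMeasurable).2 h.integrable_sq.integrableOn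

lemma exists_nice_dist_lt (Φ : Hp) {ε : ℝ} (hε : 0 < ε) :
    ∃ (A : ℝ) (φ : ℝ → ℂ) (h : Nice A φ), dist Φ (h.memLp.toLp φ) ≤ ε := by
  obtain ⟨g, hg, hd, hc, hgm⟩ := (Lp.memLp Φ).exists_hasCompactSupport_eLpNorm_sub_le
    (by simp) (ε := ENNReal.ofReal ε) (by simpa using hε)
  obtain ⟨C, hC⟩ := hg.exists_bound_of_continuous hc
  obtain ⟨r, hr⟩ := hg.isCompact.isBounded.subset_ball 0
  have hn : Nice (max C r) (Set.indicator (Set.Ioi 0) g) := by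
    refine ⟨hc.measurable.indicator measurableSet_Ioi, fun k => ?_, fun k hk => ?_⟩
    · exact (norm_indicator_le_norm_self _ _).trans ((hC k).trans (le_max_left _ _))
    · by_cases h0 : 0 < k
      · rw [Set.indicator_of_mem (Set.mem_Ioi.2 h0)]
        refine image_eq_zero_of_notMem_tsupport fun hk' => hk ⟨h0, ?_⟩
        have := hr hk'
        rw [mem_ball_zero_iff, Real.norm_eq_abs] at this
        exact (le_abs_self k).trans_lt (this.trans_le (le_max_right _ _))
      · exact Set.indicator_of_notMem (by simpa using h0) _
  refine ⟨_, _, hn, ?_⟩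
  rw [Lp.dist_def]
  refine ENNReal.toReal_le_of_le_ofReal hε.le ((le_of_eq (eLpNorm_congr_ae ?_)).trans hd)
  filter_upwards [hn.memLp.coeFn_toLp, ae_restrict_mem measurableSet_Ioi] with k h1 h2
  rw [Pi.sub_apply, Pi.sub_apply, h1, Set.indicator_of_mem h2]

lemma norm_inner_le_of_nice {T : Hp →L[ℂ] Hp} {C : ℝ}
    (hT : ∀ (A : ℝ) (φ : ℝ → ℂ) (h : Nice A φ),
      ‖inner ℂ (h.memLp.toLp φ) (T (h.memLp.toLp φ))‖ ≤ C * ‖h.memLp.toLp φ‖ ^ 2) (Φ : Hp) :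
    ‖inner ℂ Φ (T Φ)‖ ≤ C * ‖Φ‖ ^ 2 := by
  have hcl : IsClosed {Φ : Hp | ‖inner ℂ Φ (T Φ)‖ ≤ C * ‖Φ‖ ^ 2} :=
    isClosed_le (by fun_prop) (by fun_prop)
  refine hcl.closure_subset (Metric.mem_closure_iff.2 fun ε hε => ?_)
  obtain ⟨A, φ, h, hd⟩ := exists_nice_dist_lt Φ (half_pos hε)
  exact ⟨_, hT A φ h, hd.trans_lt (half_lt_self hε)⟩

section

variable {S : ℝ → Hp →L[ℂ] Hp} {R : Hp →L[ℂ] HL} {Pm : HL →L[ℂ] HL}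

lemma Setup.isSelfAdjoint_Pm (hs : Setup S R Pm) : IsSelfAdjoint Pm := by
  rw [ContinuousLinearMap.isSelfAdjoint_iff_isSymmetric]
  intro f g
  simp only [ContinuousLinearMap.coe_coe]
  rw [L2.inner_def, L2.inner_def]
  refine integral_congr_ae ?_
  filter_upwards [hs.hPm f, hs.hPm g] with x h1 h2
  rw [h1, h2]
  by_cases hx : x ∈ Set.Iio (0 : ℝ)
  · rw [Set.indicator_of_mem hx, Set.indicator_of_mem hx]
  · rw [Set.indicator_of_notMem hx, Set.indicator_of_notMem hx, inner_zero_left, inner_zero_right]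

lemma Setup.isSelfAdjoint_BM (hs : Setup S R Pm) (M : ℕ) (t : Fin (2 * M) → ℝ) :
    IsSelfAdjoint (BM S R Pm M t) := by
  rw [BM]
  refine isSelfAdjoint_sum _ fun j _ => ?_
  exact ((hs.isSelfAdjoint_Pm.adjoint_conj R).adjoint_conj _).sub
    ((hs.isSelfAdjoint_Pm.adjoint_conj R).adjoint_conj _)

lemma Setup.norm_inner_BM_le (hs : Setup S R Pm) {M : ℕ} (hM : 1 ≤ M) (Φ : Hp) :
    ‖inner ℂ Φ (BM S R Pm M (tMlist M) Φ)‖ ≤ 7007 * (M : ℝ) ^ ((1 : ℝ) / 4) * ‖Φ‖ ^ 2 :=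
  norm_inner_le_of_nice (fun _ _ h => h.norm_inner_BM_le hs h.memLp.coeFn_toLp hM) Φ

lemma Setup.abs_re_inner_BM_le (hs : Setup S R Pm) {M : ℕ} (hM : 1 ≤ M) (Φ : Hp) :
    |RCLike.re (inner ℂ (BM S R Pm M (tMlist M) Φ) Φ)| ≤
      7007 * (M : ℝ) ^ ((1 : ℝ) / 4) * ‖Φ‖ ^ 2 := by
  refine (RCLike.abs_re_le_norm _).trans ?_
  rw [norm_inner_symm]
  exact hs.norm_inner_BM_le hM Φ

lemma Setup.abs_le_of_mem_spectrum (hs : Setup S R Pm) {M : ℕ} (hM : 1 ≤ M) {r : ℝ}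
    (hr : r ∈ spectrum ℝ (BM S R Pm M (tMlist M))) : |r| ≤ 7007 * (M : ℝ) ^ ((1 : ℝ) / 4) := by
  have h := hs.abs_re_inner_BM_le hM
  rw [abs_le]
  constructor
  · refine (forall_le_spectrum_iff (hs.isSelfAdjoint_BM _ _) _).2 (fun x => ?_) r hr
    rw [neg_mul]
    exact (abs_le.1 (h x)).1
  · exact (forall_spectrum_le_iff (hs.isSelfAdjoint_BM _ _) _).2 (fun x => (abs_le.1 (h x)).2) r hr

lemma Setup.sSup_spectrum_le (hs : Setup S R Pm) {M : ℕ} (hM : 1 ≤ M) :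
    sSup (spectrum ℝ (BM S R Pm M (tMlist M))) ≤ 7007 * (M : ℝ) ^ ((1 : ℝ) / 4) :=
  Real.sSup_le (fun _ hr => (abs_le.1 (hs.abs_le_of_mem_spectrum hM hr)).2) (by positivity)

lemma Setup.le_sInf_spectrum (hs : Setup S R Pm) {M : ℕ} (hM : 1 ≤ M) :
    -(7007 * (M : ℝ) ^ ((1 : ℝ) / 4)) ≤ sInf (spectrum ℝ (BM S R Pm M (tMlist M))) :=
  Real.le_sInf (fun _ hr => (abs_le.1 (hs.abs_le_of_mem_spectrum hM hr)).1)
    (neg_nonpos.2 (by positivity))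

end

/-- The indicator function of an open interval. -/
def bump (c d : ℝ) : ℝ → ℝ := Set.indicator (Set.Ioo c d) 1

lemma measurable_bump (c d : ℝ) : Measurable (bump c d) :=
  measurable_one.indicator measurableSet_Ioo

lemma integrable_bump (c d : ℝ) : Integrable (bump c d) :=
  (integrable_indicator_iff measurableSet_Ioo).2 (integrableOn_const (by simp) (by simp))

lemma integral_bump {c d : ℝ} (h : c ≤ d) : ∫ k, bump c d k = d - c := by
  rw [bump, integral_indicator_one measurableSet_Ioo, Real.volume_real_Ioo_of_le h]

lemma bump_of_mem {c d k : ℝ} (h : k ∈ Set.Ioo c d) : bump c d k = 1 :=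
  Set.indicator_of_mem h _

lemma bump_of_notMem {c d k : ℝ} (h : k ∉ Set.Ioo c d) : bump c d k = 0 :=
  Set.indicator_of_notMem h _

/-- A wave packet with a low-momentum part of size `α` on `(0, a)` and a high-momentum part of
size `β` on `(b - w, b)`. -/
def packet (a b w α β k : ℝ) : ℝ := α * bump 0 a k + β * bump (b - w) b k

lemma measurable_packet (a b w α β : ℝ) : Measurable (packet a b w α β) :=
  ((measurable_bump _ _).const_mul _).add ((measurable_bump _ _).const_mul _)

section

variable {a b w : ℝ}

lemma nice_packet (hab : a ≤ b - w) (ha : 0 ≤ a) (hw : 0 ≤ w) (α β : ℝ) :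
    ∃ A, Nice A (fun k => (packet a b w α β k : ℂ)) := by
  refine ⟨max b (|α| + |β|), ?_, fun k => ?_, fun k hk => ?_⟩
  · have := measurable_packet a b w α β
    fun_prop
  · rw [Complex.norm_real, Real.norm_eq_abs]
    refine le_max_of_le_right ((abs_add_le _ _).trans ?_)
    have h : ∀ c d : ℝ, |bump c d k| ≤ 1 := by
      intro c d
      by_cases hk : k ∈ Set.Ioo c d
      · rw [bump_of_mem hk, abs_one]
      · rw [bump_of_notMem hk, abs_zero]; exact zero_le_one
    rw [abs_mul, abs_mul]
    exact add_le_add (mul_le_of_le_one_right (abs_nonneg _) (h _ _))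
      (mul_le_of_le_one_right (abs_nonneg _) (h _ _))
  · have hm : ∀ {x : ℝ}, x < b → x < max b (|α| + |β|) := fun hx => hx.trans_le (le_max_left _ _)
    rw [packet, bump_of_notMem, bump_of_notMem]
    · simp
    · exact fun h => hk ⟨by linarith [h.1], hm h.2⟩
    · exact fun h => hk ⟨h.1, hm (by linarith [h.2])⟩

/-- Every point is in exactly one of the two pieces of the packet or outside both. -/
lemma bump_cases (hab : a ≤ b - w) (k : ℝ) :
    (k ∈ Set.Ioo 0 a ∧ bump 0 a k = 1 ∧ bump (b - w) b k = 0) ∨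
    (k ∈ Set.Ioo (b - w) b ∧ bump 0 a k = 0 ∧ bump (b - w) b k = 1) ∨
    (bump 0 a k = 0 ∧ bump (b - w) b k = 0) := by
  by_cases h1 : k ∈ Set.Ioo 0 a
  · exact Or.inl ⟨h1, bump_of_mem h1, bump_of_notMem fun h => by linarith [h1.2, h.1]⟩
  by_cases h2 : k ∈ Set.Ioo (b - w) b
  · exact Or.inr (Or.inl ⟨h2, bump_of_notMem h1, bump_of_mem h2⟩)
  · exact Or.inr (Or.inr ⟨bump_of_notMem h1, bump_of_notMem h2⟩)

lemma integral_packet_sq (hab : a ≤ b - w) (ha : 0 ≤ a) (hw : 0 ≤ w) (α β : ℝ) :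
    ∫ k in Set.Ioi (0 : ℝ), packet a b w α β k ^ 2 = α ^ 2 * a + β ^ 2 * w := by
  have e : ∀ k, packet a b w α β k ^ 2 = α ^ 2 * bump 0 a k + β ^ 2 * bump (b - w) b k := by
    intro k
    rw [packet]
    rcases bump_cases hab k with ⟨-, h1, h2⟩ | ⟨-, h1, h2⟩ | ⟨h1, h2⟩ <;> rw [h1, h2] <;> ring
  rw [setIntegral_eq_integral_of_forall_compl_eq_zero]
  · simp only [e]
    rw [integral_add ((integrable_bump _ _).const_mul _) ((integrable_bump _ _).const_mul _),
      integral_const_mul, integral_const_mul, integral_bump ha, integral_bump (by linarith)]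
    ring
  · intro k hk
    have hk' : k ≤ 0 := not_lt.1 hk
    rw [packet, bump_of_notMem fun h => by linarith [h.1],
      bump_of_notMem fun h => by linarith [h.1]]
    ring

lemma abs_formKernel_le {M : ℕ} {c k q : ℝ} (hk : k ∈ Set.Icc 0 c) (hq : q ∈ Set.Icc 0 c) :
    |formKernel M (k, q)| ≤ 2 * c * M := by
  rw [formKernel, abs_mul, abs_of_nonneg (add_nonneg hk.1 hq.1)]
  have h1 := hk.2
  have h2 := hq.2
  exact mul_le_mul (by linarith) (abs_dker_le _ _) (abs_nonneg _)
    (by linarith [hk.1])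

lemma formKernel_swap (M : ℕ) (k q : ℝ) : formKernel M (k, q) = formKernel M (q, k) := by
  simp only [formKernel]
  rw [← dker_neg, add_comm, neg_sub]

/-- Between the low and the high momentum part the kernel has a definite sign. -/
lemma le_neg_one_pow_mul_formKernel {M : ℕ} (hM : 1 ≤ M) (hb : b ^ 2 = Real.pi) (hb1 : 1 ≤ b - w)
    (hw : M * (2 * b * w + a ^ 2) ≤ Real.pi / 2) {k q : ℝ} (hk : k ∈ Set.Ioo 0 a)
    (hq : q ∈ Set.Ioo (b - w) b) :
    2 / 5 * (M : ℝ) ≤ (-1) ^ (M + 1) * formKernel M (q, k) := by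
  have hb0 : 1 < b := by linarith [hq.1, hq.2]
  have h0 : 0 < Real.pi - q ^ 2 + k ^ 2 := by nlinarith [hk.1, hq.1, hq.2]
  have h1 : Real.pi - q ^ 2 + k ^ 2 ≤ 2 * b * w + a ^ 2 := by nlinarith [hk.1, hk.2, hq.1, hq.2]
  have h2 := le_neg_one_pow_mul_dker hM h0 ((mul_le_mul_of_nonneg_left h1 (by positivity)).trans hw)
  rw [show Real.pi - (Real.pi - q ^ 2 + k ^ 2) = q ^ 2 - k ^ 2 by ring] at h2
  have h3 : 1 ≤ q + k := by linarith [hk.1, hq.1]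
  simp only [formKernel]
  have h4 : (0 : ℝ) ≤ M := by positivity
  nlinarith [mul_le_mul_of_nonneg_right h3 (le_trans (by positivity) h2)]

lemma le_packet_mul_formKernel {M : ℕ} (hM : 1 ≤ M) (hb : b ^ 2 = Real.pi) (hb1 : 1 ≤ b - w)
    (hab : a ≤ b - w) (hw : M * (2 * b * w + a ^ 2) ≤ Real.pi / 2) {α β s τ : ℝ} (hα : 0 ≤ α)
    (hβ : 0 ≤ β) (hτ : |τ| = 1) (hs : τ * s = (-1) ^ (M + 1)) (hs1 : s ^ 2 = 1) (k q : ℝ) :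
    2 / 5 * M * α * β * (bump 0 a k * bump (b - w) b q)
      + 2 / 5 * M * α * β * (bump (b - w) b k * bump 0 a q)
      - α ^ 2 * (2 * a * M) * (bump 0 a k * bump 0 a q)
      - β ^ 2 * (2 * b * M) * (bump (b - w) b k * bump (b - w) b q) ≤
    τ * (packet a b w α (s * β) k * packet a b w α (s * β) q * formKernel M (k, q)) := by
  have hτF : ∀ F : ℝ, -|F| ≤ τ * F := by
    intro F
    have := neg_abs_le (τ * F)
    rwa [abs_mul, hτ, one_mul] at this
  have hdiag : ∀ {c : ℝ}, k ∈ Set.Icc 0 c → q ∈ Set.Icc 0 c →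
      -(2 * c * M) ≤ τ * formKernel M (k, q) := fun h1 h2 =>
    (neg_le_neg (abs_formKernel_le h1 h2)).trans (hτF _)
  have hαβ := mul_nonneg hα hβ
  rw [packet, packet]
  rcases bump_cases hab k with ⟨hk, h1, h2⟩ | ⟨hk, h1, h2⟩ | ⟨h1, h2⟩ <;>
  rcases bump_cases hab q with ⟨hq, h3, h4⟩ | ⟨hq, h3, h4⟩ | ⟨h3, h4⟩ <;>
  rw [h1, h2, h3, h4] <;> ring_nf <;> try exact le_rfl
  · have h := hdiag ⟨hk.1.le, hk.2.le⟩ ⟨hq.1.le, hq.2.le⟩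
    nlinarith [mul_le_mul_of_nonneg_left h (sq_nonneg α)]
  · have h := le_neg_one_pow_mul_formKernel hM hb hb1 hw hk hq
    rw [← formKernel_swap, ← hs] at h
    nlinarith [mul_le_mul_of_nonneg_left h hαβ]
  · have h := le_neg_one_pow_mul_formKernel hM hb hb1 hw hq hk
    rw [← hs] at h
    nlinarith [mul_le_mul_of_nonneg_left h hαβ]
  · have h := hdiag ⟨by linarith [hk.1], hk.2.le⟩ ⟨by linarith [hq.1], hq.2.le⟩
    rw [hs1]
    nlinarith [mul_le_mul_of_nonneg_left h (sq_nonneg β)]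

lemma integrable_bump_mul_bump (c d c' d' : ℝ) :
    Integrable (fun p : ℝ × ℝ => bump c d p.1 * bump c' d' p.2) (volume.prod volume) :=
  (integrable_bump c d).mul_prod (integrable_bump c' d')

lemma integral_bump_mul_bump {c d c' d' : ℝ} (h : c ≤ d) (h' : c' ≤ d') :
    ∫ p : ℝ × ℝ, bump c d p.1 * bump c' d' p.2 ∂(volume.prod volume) = (d - c) * (d' - c') := by
  rw [integral_prod_mul, integral_bump h, integral_bump h']

lemma pairing_ofReal_mul_formKernel (f : ℝ → ℝ) (M : ℕ) (p : ℝ × ℝ) :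
    pairing (fun k => (f k : ℂ)) p * formKernel M p =
      ((f p.1 * f p.2 * formKernel M p : ℝ) : ℂ) := by
  rw [pairing, Complex.conj_ofReal]
  push_cast
  ring

lemma le_integral_packet {M : ℕ} (hM : 1 ≤ M) (hb : b ^ 2 = Real.pi) (hb1 : 1 ≤ b - w)
    (hab : a ≤ b - w) (ha0 : 0 ≤ a) (hw0 : 0 ≤ w) (hw : M * (2 * b * w + a ^ 2) ≤ Real.pi / 2)
    {α β s τ : ℝ} (hα : 0 ≤ α)
    (hβ : 0 ≤ β) (hτ : |τ| = 1) (hs : τ * s = (-1) ^ (M + 1)) (hs1 : s ^ 2 = 1) :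
    4 / 5 * M * α * β * a * w - 2 * M * α ^ 2 * a ^ 3 - 2 * M * b * β ^ 2 * w ^ 2 ≤
    τ * ∫ p : ℝ × ℝ, packet a b w α (s * β) p.1 * packet a b w α (s * β) p.2 * formKernel M p
      ∂(volume.prod volume) := by
  have i1 := (integrable_bump_mul_bump 0 a (b - w) b).const_mul (2 / 5 * M * α * β)
  have i2 := (integrable_bump_mul_bump (b - w) b 0 a).const_mul (2 / 5 * M * α * β)
  have i3 := (integrable_bump_mul_bump 0 a 0 a).const_mul (α ^ 2 * (2 * a * M))
  have i4 := (integrable_bump_mul_bump (b - w) b (b - w) b).const_mul (β ^ 2 * (2 * b * M))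
  obtain ⟨A, hn⟩ := nice_packet hab ha0 hw0 α (s * β)
  have i5 := (hn.integrable_pairing_mul M).re
  simp only [pairing_ofReal_mul_formKernel, RCLike.re_eq_complex_re, Complex.ofReal_re] at i5
  rw [← integral_const_mul]
  refine le_trans (le_of_eq ?_) (integral_mono (((i1.add i2).sub i3).sub i4) (i5.const_mul τ)
    fun p => le_packet_mul_formKernel hM hb hb1 hab hw hα hβ hτ hs hs1 p.1 p.2)
  have hwb : b - w ≤ b := by linarith
  rw [integral_sub' ((i1.add i2).sub i3) i4, integral_sub' (i1.add i2) i3, integral_add' i1 i2,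
    integral_const_mul, integral_const_mul, integral_const_mul, integral_const_mul,
    integral_bump_mul_bump ha0 hwb, integral_bump_mul_bump hwb ha0, integral_bump_mul_bump ha0 ha0,
    integral_bump_mul_bump hwb hwb]
  ring

end

section

variable {S : ℝ → Hp →L[ℂ] Hp} {R : Hp →L[ℂ] HL} {Pm : HL →L[ℂ] HL}

/-- Both signs of the quadratic form reach a multiple of `M ^ (1/4)`. -/
lemma Setup.exists_le_mul_re_inner (hs : Setup S R Pm) {M : ℕ} (hM : 1 ≤ M) {τ : ℝ}
    (hτ : τ = 1 ∨ τ = -1) : ∃ Φ : Hp, Φ ≠ 0 ∧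
      1 / 100000 * (M : ℝ) ^ ((1 : ℝ) / 4) * ‖Φ‖ ^ 2 ≤
        τ * RCLike.re (inner ℂ (BM S R Pm M (tMlist M) Φ) Φ) := by
  set m := (M : ℝ) ^ ((1 : ℝ) / 4) with hm
  have hM' : (1 : ℝ) ≤ M := by exact_mod_cast hM
  have hm1 : 1 ≤ m := Real.one_le_rpow hM' (by norm_num)
  have hm4 : m ^ 4 = M := by
    rw [hm, ← Real.rpow_mul_natCast (by positivity)]
    norm_num
  have hτabs : |-τ| = 1 := by rcases hτ with rfl | rfl <;> simp
  have hτ2 : τ * τ = 1 := by rcases hτ with rfl | rfl <;> norm_num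
  set s : ℝ := -τ * (-1) ^ (M + 1) with hsdef
  have hs1 : -τ * s = (-1) ^ (M + 1) := by rw [hsdef, ← mul_assoc, neg_mul_neg, hτ2, one_mul]
  have hs2 : s ^ 2 = 1 := by
    rw [hsdef, mul_pow, ← pow_mul, mul_comm (M + 1), pow_mul]
    rw [neg_sq, neg_sq, one_pow, one_pow, mul_one, sq, hτ2]
  have hpi3 := Real.pi_gt_d2
  have hpi4 := Real.pi_lt_d2
  set b := Real.sqrt Real.pi with hbdef
  have hb : b ^ 2 = Real.pi := Real.sq_sqrt Real.pi_pos.le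
  have hb0 : 0 ≤ b := Real.sqrt_nonneg _
  have hb2 : b ≤ 2 := by nlinarith
  have hb3 : 17 / 10 ≤ b := by nlinarith
  set a := 1 / (100 * m ^ 2) with ha
  set w := 1 / (10000 * m ^ 4) with hw
  have hm0 : 0 < m := by linarith
  have hm2 : 1 ≤ m ^ 2 := one_le_pow₀ hm1
  have ha0 : 0 ≤ a := by positivity
  have hw0 : 0 ≤ w := by positivity
  have ha1 : a ≤ 1 / 100 := by
    rw [ha]; exact one_div_le_one_div_of_le (by norm_num) (by linarith)
  have hw1 : w ≤ 1 / 10000 := by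
    rw [hw]; exact one_div_le_one_div_of_le (by norm_num) (by linarith)
  have hMw : M * w = 1 / 10000 := by rw [hw, ← hm4]; field_simp
  have hMa : M * a ^ 2 = 1 / 10000 := by rw [ha, ← hm4]; field_simp; norm_num
  have hab : a ≤ b - w := by linarith
  obtain ⟨A, hn⟩ := nice_packet hab ha0 hw0 (10 * m) (s * (100 * m ^ 2))
  have key := le_integral_packet hM hb (by linarith) hab ha0 hw0 (by nlinarith)
    (α := 10 * m) (β := 100 * m ^ 2) (by positivity) (by positivity) hτabs hs1 hs2
  have hnorm : ‖hn.memLp.toLp‖ ^ 2 = 2 := by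
    rw [norm_sq_eq_integral]
    have : ∫ k, ‖hn.memLp.toLp _ k‖ ^ 2 ∂μp =
        ∫ k in Set.Ioi (0 : ℝ), packet a b w (10 * m) (s * (100 * m ^ 2)) k ^ 2 := by
      refine integral_congr_ae ?_
      filter_upwards [hn.memLp.coeFn_toLp] with k hk
      rw [hk, Complex.norm_real, Real.norm_eq_abs, sq_abs]
    rw [this, integral_packet_sq hab ha0 hw0, mul_pow s, hs2, ha, hw]
    field_simp
    norm_num
  refine ⟨hn.memLp.toLp, fun h => by rw [h] at hnorm; norm_num at hnorm, ?_⟩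
  rw [hnorm, inner_re_symm, hn.inner_BM_eq hs hn.memLp.coeFn_toLp M]
  simp only [pairing_ofReal_mul_formKernel]
  rw [integral_complex_ofReal]
  set Q := ∫ p : ℝ × ℝ, packet a b w (10 * m) (s * (100 * m ^ 2)) p.1 *
    packet a b w (10 * m) (s * (100 * m ^ 2)) p.2 * formKernel M p ∂(volume.prod volume)
  have e1 : -(1 / (2 * (Real.pi : ℂ))) * (Q : ℂ) = ((-(1 / (2 * Real.pi)) * Q : ℝ) : ℂ) := by
    push_cast; ring
  rw [e1, RCLike.re_eq_complex_re, Complex.ofReal_re]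
  have k1 : 4 / 5 * M * (10 * m) * (100 * m ^ 2) * a * w = 8 / 10000 * m := by
    rw [ha, hw, ← hm4]; field_simp; norm_num
  have k2 : 2 * M * (10 * m) ^ 2 * a ^ 3 = 2 / 10000 := by
    rw [ha, ← hm4]; field_simp; norm_num
  have k3 : 2 * M * b * (100 * m ^ 2) ^ 2 * w ^ 2 = 2 / 10000 * b := by
    rw [hw, ← hm4]; field_simp; norm_num
  rw [k1, k2, k3] at key
  have key2 : 2 / 10000 * m ≤ -τ * Q := le_trans (by linarith) key
  rw [show τ * (-(1 / (2 * Real.pi)) * Q) = (-τ * Q) / (2 * Real.pi) by ring,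
    le_div_iff₀ (by positivity)]
  nlinarith

lemma Setup.le_sSup_spectrum (hs : Setup S R Pm) {M : ℕ} (hM : 1 ≤ M) :
    1 / 100000 * (M : ℝ) ^ ((1 : ℝ) / 4) ≤ sSup (spectrum ℝ (BM S R Pm M (tMlist M))) := by
  obtain ⟨Φ, h0, h⟩ := hs.exists_le_mul_re_inner hM (Or.inl rfl)
  rw [one_mul] at h
  exact QB.le_sSup_spectrum (hs.isSelfAdjoint_BM M _)
    (fun x => (abs_le.1 (hs.abs_re_inner_BM_le hM x)).2) h0 h

lemma Setup.sInf_spectrum_le (hs : Setup S R Pm) {M : ℕ} (hM : 1 ≤ M) :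
    sInf (spectrum ℝ (BM S R Pm M (tMlist M))) ≤ -(1 / 100000 * (M : ℝ) ^ ((1 : ℝ) / 4)) := by
  obtain ⟨Φ, h0, h⟩ := hs.exists_le_mul_re_inner hM (Or.inr rfl)
  refine QB.sInf_spectrum_le (hs.isSelfAdjoint_BM M _)
    (C := -(7007 * (M : ℝ) ^ ((1 : ℝ) / 4))) (fun x => ?_) h0 (by linarith)
  rw [neg_mul]
  exact (abs_le.1 (hs.abs_re_inner_BM_le hM x)).1

end

lemma rpow_neg_mul_rpow_quarter {M : ℕ} (hM : 1 ≤ M) (c : ℝ) :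
    (M : ℝ) ^ (-(1 : ℝ) / 4) * (c * (M : ℝ) ^ ((1 : ℝ) / 4)) = c := by
  have hM' : (0 : ℝ) < M := by exact_mod_cast hM
  rw [mul_left_comm, ← Real.rpow_add hM']
  norm_num

/-- there is `k > 0` with `sSup σ(B^{(M)}_{t_M}) ≥ k M^{1/4}` for all even
`M ≥ 2`, `liminf M^{-1/4} sSup σ(B^{(M)}_{t_M}) ≥ k` and
`limsup M^{-1/4} sInf σ(B^{(M)}_{t_M}) ≤ -k` as `M → ∞`. -/
theorem backflow_unbounded_growth
    (S : ℝ → Hp →L[ℂ] Hp) (R : Hp →L[ℂ] HL) (Pm : HL →L[ℂ] HL)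
    (hSetup : Setup S R Pm) :
    ∃ k : ℝ, 0 < k ∧
      (∀ M : ℕ, 2 ≤ M → Even M →
        k * (M:ℝ) ^ ((1:ℝ)/4) ≤ sSup (spectrum ℝ (BM S R Pm M (tMlist M)))) ∧
      k ≤ liminf (fun M : ℕ =>
            (M:ℝ) ^ (-(1:ℝ)/4) * sSup (spectrum ℝ (BM S R Pm M (tMlist M)))) atTop ∧
      limsup (fun M : ℕ =>
            (M:ℝ) ^ (-(1:ℝ)/4) * sInf (spectrum ℝ (BM S R Pm M (tMlist M)))) atTop ≤ -k := by
  have hle : ∀ {M : ℕ} {c x : ℝ}, 1 ≤ M → c * (M : ℝ) ^ ((1 : ℝ) / 4) ≤ x →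
      c ≤ (M : ℝ) ^ (-(1 : ℝ) / 4) * x := fun {M c x} hM h => by
    rw [← rpow_neg_mul_rpow_quarter hM c]
    exact mul_le_mul_of_nonneg_left h (by positivity)
  have hge : ∀ {M : ℕ} {c x : ℝ}, 1 ≤ M → x ≤ c * (M : ℝ) ^ ((1 : ℝ) / 4) →
      (M : ℝ) ^ (-(1 : ℝ) / 4) * x ≤ c := fun {M c x} hM h => by
    rw [← rpow_neg_mul_rpow_quarter hM c]
    exact mul_le_mul_of_nonneg_left h (by positivity)
  refine ⟨1 / 100000, by norm_num, fun M hM _ => hSetup.le_sSup_spectrum (by omega), ?_, ?_⟩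
  · refine le_liminf_of_le ?_ ?_
    · refine IsBoundedUnder.isCoboundedUnder_ge ⟨7007, ?_⟩
      rw [eventually_map]
      filter_upwards [eventually_ge_atTop 1] with M hM
      exact hge hM (hSetup.sSup_spectrum_le hM)
    · filter_upwards [eventually_ge_atTop 1] with M hM
      exact hle hM (hSetup.le_sSup_spectrum hM)
  · refine limsup_le_of_le ?_ ?_
    · refine IsBoundedUnder.isCoboundedUnder_le ⟨-7007, ?_⟩
      rw [eventually_map]
      filter_upwards [eventually_ge_atTop 1] with M hM
      refine hle hM ?_
      rw [neg_mul]
      exact hSetup.le_sInf_spectrum hM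
    · filter_upwards [eventually_ge_atTop 1] with M hM
      refine hge hM ?_
      rw [neg_mul]
      exact hSetup.sInf_spectrum_le hM

end QB
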